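/- arXiv:2506.02640 — 2 statements merged into one kernel-verified Lean document; each statement's English description precedes it below -/
import Mathlib

section
/- Let r > 2 and define f₁(r) = [1 + 2·((r−2)/r)·√(r²−1) + 3·((r−2)/r) − (3/r)·((r−2)/r)·√(r²−1) + ((r−2)/r)²·(r − √(r²−1) + r²·π/4)] / [(1/4)·(r−2)²·(1/2)^(−log 4/log r)·(r−2)^(−log 4/log r)]. Then for every integer n ≥ 1, with ε = (1/2)·((r−2)/r)·r^(−(n−1)), one has λ²((C^r)_ε) / ε^(2 − D_r) > f₁(r), where D_r = log 4 / log r. -/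
open MeasureTheory Metric Set Real Filter Topology ENNReal

/-- The similarity map `x ↦ x/r + (a, b)` of the plane. -/
noncomputable def cantorMap (r a b : ℝ) (x : EuclideanSpace ℝ (Fin 2)) :
    EuclideanSpace ℝ (Fin 2) :=
  r⁻¹ • x + (WithLp.equiv 2 (Fin 2 → ℝ)).symm ![a, b]

/-- `C` is the Cantor dust with parameter `r`: the (unique) nonempty compact set invariant
under the four similarities `S₁, S₂, S₃, S₄`. -/
def IsCantorDust (r : ℝ) (C : Set (EuclideanSpace ℝ (Fin 2))) : Prop :=
  IsCompact C ∧ C.Nonempty ∧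
    C = cantorMap r 0 0 '' C ∪ cantorMap r ((r - 1) / r) 0 '' C ∪
        cantorMap r ((r - 1) / r) ((r - 1) / r) '' C ∪ cantorMap r 0 ((r - 1) / r) '' C

/-- The lower-bound function `f₁` from Equation (12) of the paper. -/
noncomputable def f₁ (r : ℝ) : ℝ :=
  (1 + 2 * ((r - 2) / r) * Real.sqrt (r ^ 2 - 1) + 3 * ((r - 2) / r) -
      3 / r * ((r - 2) / r) * Real.sqrt (r ^ 2 - 1) +
      ((r - 2) / r) ^ 2 * (r - Real.sqrt (r ^ 2 - 1) + r ^ 2 * π / 4)) /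
    (1 / 4 * (r - 2) ^ 2 * (1 / 2 : ℝ) ^ (-(Real.log 4 / Real.log r)) *
      (r - 2) ^ (-(Real.log 4 / Real.log r)))

/-- The upper-bound function `f₂` from Equation (15) of the paper. -/
noncomputable def f₂ (r : ℝ) : ℝ :=
  (1 + Real.sqrt 8 * ((r - 2) / r) + π / 2 * ((r - 2) / r) ^ 2) /
    (1 / 2 * ((r - 2) / r) ^ 2 * Real.sqrt (1 / 2) ^ (-(Real.log 4 / Real.log r)) *
      ((r - 2) / r) ^ (-(Real.log 4 / Real.log r)))


theorem vol_slice_le {S : Set ℝ} (hS : MeasurableSet S) {f : ℝ → ℝ}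
    (hf : IntegrableOn f S) (hf0 : ∀ x ∈ S, 0 ≤ f x) {F : Set (ℝ × ℝ)} (hF : MeasurableSet F)
    (h : ∀ x ∈ S, ENNReal.ofReal (f x) ≤ volume (Prod.mk x ⁻¹' F)) :
    ENNReal.ofReal (∫ x in S, f x) ≤ volume F := by
  rw [ofReal_integral_eq_lintegral_ofReal hf
    ((ae_restrict_iff' hS).2 (Eventually.of_forall hf0)), Measure.volume_eq_prod,
    Measure.prod_apply hF]
  exact (setLIntegral_mono' hS h).trans (setLIntegral_le_lintegral _ _)

theorem integral_sqrt_sq_sub_sq {ρ : ℝ} (hρ : 0 < ρ) :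
    ∫ x in (-ρ)..ρ, √(ρ ^ 2 - x ^ 2) = π * ρ ^ 2 / 2 := by
  have h := intervalIntegral.mul_integral_comp_mul_left (a := -1) (b := 1)
    (f := fun x => √(ρ ^ 2 - x ^ 2)) ρ
  have h2 : ∀ x : ℝ, √(ρ ^ 2 - (ρ * x) ^ 2) = ρ * √(1 - x ^ 2) := fun x => by
    rw [show ρ ^ 2 - (ρ * x) ^ 2 = ρ ^ 2 * (1 - x ^ 2) by ring, sqrt_mul (by positivity),
      sqrt_sq hρ.le]
  simp only [h2, intervalIntegral.integral_const_mul, integral_sqrt_one_sub_sq] at h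
  rw [mul_neg, mul_one] at h
  rw [← h]; ring

theorem three_mul_add_sqrt_lt {r : ℝ} (hr : 2 < r) :
    3 * r + √(r ^ 2 - 1) < 4 * √(r ^ 2 - (1 / r) ^ 2) := by
  have hr0 : 0 < r := by linarith
  have h1 : (1 / r) ^ 2 < 1 / 4 := by
    rw [div_pow, one_pow]; apply one_div_lt_one_div_of_lt <;> nlinarith
  set w := (1 / r) ^ 2
  have hw0 : 0 < w := by positivity
  set s := √(r ^ 2 - 1)
  set q := √(r ^ 2 - w)
  have hs : s ^ 2 = r ^ 2 - 1 := sq_sqrt (by nlinarith)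
  have hq : q ^ 2 = r ^ 2 - w := sq_sqrt (by nlinarith)
  have hs0 : 0 ≤ s := sqrt_nonneg _
  have hq0 : 0 ≤ q := sqrt_nonneg _
  have hsq : s < q := sqrt_lt_sqrt (by nlinarith) (by linarith)
  have hqr : q < r := by nlinarith
  by_contra! hc
  nlinarith [mul_pos (sub_pos.2 hqr) (sub_pos.2 hsq), mul_nonneg (sub_nonneg.2 hc) (add_nonneg hr0.le hs0)]

theorem measurePreserving_coords :
    MeasurePreserving (fun x : EuclideanSpace ℝ (Fin 2) => (x 0, x 1)) :=
  (volume_preserving_finTwoArrow ℝ).comp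
    (EuclideanSpace.volume_preserving_symm_measurableEquiv_toLp (Fin 2))

theorem ofReal_two_mul_le_volume_Ioo_union {t : ℝ} (ht : 0 ≤ t) {A : Set ℝ}
    (h0 : Ioo (-t) 0 ⊆ A) (h1 : Ioo 1 (1 + t) ⊆ A) : ENNReal.ofReal (2 * t) ≤ volume A := by
  refine le_trans ?_ (measure_mono (union_subset h0 h1))
  rw [measure_union _ measurableSet_Ioo, Real.volume_Ioo, Real.volume_Ioo,
    ← ENNReal.ofReal_add (by linarith) (by linarith)]
  · exact ENNReal.ofReal_le_ofReal (by linarith)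
  · rw [Set.disjoint_left]
    rintro x ⟨_, hx⟩ ⟨hx', _⟩
    linarith

theorem integral_corners {ρ : ℝ} (hρ : 0 < ρ) :
    (∫ x in Ioo (-ρ) 0, 2 * √(ρ ^ 2 - x ^ 2)) + ∫ x in Ioo 1 (1 + ρ), 2 * √(ρ ^ 2 - (x - 1) ^ 2)
      = π * ρ ^ 2 := by
  rw [← integral_Ioc_eq_integral_Ioo, ← integral_Ioc_eq_integral_Ioo,
    ← intervalIntegral.integral_of_le (by linarith), ← intervalIntegral.integral_of_le (by linarith),
    intervalIntegral.integral_comp_sub_right (fun x => 2 * √(ρ ^ 2 - x ^ 2)) 1, sub_self,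
    add_sub_cancel_left, intervalIntegral.integral_add_adjacent_intervals,
    intervalIntegral.integral_const_mul, integral_sqrt_sq_sub_sq hρ]
  · ring
  all_goals exact Continuous.intervalIntegrable (by fun_prop) _ _

/-- Area of the sublevel set of `D x ^ 2 + D y ^ 2`, for a function `D` bounded by the distance
to `0` and by the distance to `1`, and small on `[0, 1]`. -/
theorem area_le_volume_sublevel {D : ℝ → ℝ} (hD : Continuous D) (hD0 : ∀ x, 0 ≤ D x)
    (hDl : ∀ x, D x ≤ |x|) (hDr : ∀ x, D x ≤ |x - 1|) {ρ η : ℝ} (hρ : 0 < ρ)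
    (hη : 2 * η ^ 2 < ρ ^ 2) (hDη : ∀ x ∈ Icc (0 : ℝ) 1, D x ≤ η) :
    ENNReal.ofReal (1 + 4 * (∫ x in Icc (0 : ℝ) 1, √(ρ ^ 2 - D x ^ 2)) + π * ρ ^ 2) ≤
      volume {p : ℝ × ℝ | D p.1 ^ 2 + D p.2 ^ 2 < ρ ^ 2} := by
  set E := {p : ℝ × ℝ | D p.1 ^ 2 + D p.2 ^ 2 < ρ ^ 2} with hE
  have hEm : MeasurableSet E := (isOpen_lt (by fun_prop) (by fun_prop)).measurableSet
  have key : ∀ x y a b, 0 ≤ a → D x ≤ b → D y ≤ a → a < √(ρ ^ 2 - b ^ 2) → (x, y) ∈ E := by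
    intro x y a b ha hx hy hab
    have h1 := (lt_sqrt ha).1 hab
    have h2 : D x ^ 2 ≤ b ^ 2 := pow_le_pow_left₀ (hD0 x) hx 2
    have h3 : D y ^ 2 ≤ a ^ 2 := pow_le_pow_left₀ (hD0 y) hy 2
    simp only [hE, mem_ofPred_eq]
    linarith
  have keyl : ∀ x b, D x ≤ b → ∀ y ∈ Ioo (-√(ρ ^ 2 - b ^ 2)) 0, (x, y) ∈ E := fun x b hx y hy =>
    key x y (-y) b (by linarith [hy.2]) hx ((hDl y).trans_eq (abs_of_neg hy.2)) (by linarith [hy.1])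
  have keyr : ∀ x b, D x ≤ b → ∀ y ∈ Ioo 1 (1 + √(ρ ^ 2 - b ^ 2)), (x, y) ∈ E :=
    fun x b hx y hy => key x y (y - 1) b (by linarith [hy.1]) hx
      ((hDr y).trans_eq (abs_of_pos (by linarith [hy.1]))) (by linarith [hy.2])
  have hI : MeasurableSet (Icc (0 : ℝ) 1) := measurableSet_Icc
  have hint : IntegrableOn (fun x => √(ρ ^ 2 - D x ^ 2)) (Icc (0 : ℝ) 1) :=
    Continuous.integrableOn_Icc (by fun_prop)
  have mid : ENNReal.ofReal (1 + 2 * ∫ x in Icc (0 : ℝ) 1, √(ρ ^ 2 - D x ^ 2)) ≤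
      volume (E ∩ Icc (0 : ℝ) 1 ×ˢ univ) := by
    have h := vol_slice_le hI (f := fun x => 1 + 2 * √(ρ ^ 2 - D x ^ 2))
      (Continuous.integrableOn_Icc (by fun_prop)) (fun _ _ => by positivity)
      (hEm.inter (hI.prod MeasurableSet.univ)) (fun x hx => by
        have hs : Ioo (-√(ρ ^ 2 - D x ^ 2)) (1 + √(ρ ^ 2 - D x ^ 2)) ⊆
            Prod.mk x ⁻¹' (E ∩ Icc (0 : ℝ) 1 ×ˢ univ) := by
          intro y hy
          refine ⟨?_, hx, trivial⟩
          rcases lt_or_ge y 0 with h | h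
          · exact keyl x _ le_rfl y ⟨hy.1, h⟩
          rcases lt_or_ge 1 y with h' | h'
          · exact keyr x _ le_rfl y ⟨h', hy.2⟩
          have h2 := pow_le_pow_left₀ (hD0 x) (hDη x hx) 2
          have h3 := pow_le_pow_left₀ (hD0 y) (hDη y ⟨h, h'⟩) 2
          simp only [hE, mem_ofPred_eq]
          linarith
        refine le_trans ?_ (measure_mono hs)
        rw [Real.volume_Ioo]
        exact ENNReal.ofReal_le_ofReal (by linarith))
    rw [integral_add (by simp) (hint.const_mul 2), integral_const_mul] at h
    simpa using h
  have side : ENNReal.ofReal (2 * ∫ x in Icc (0 : ℝ) 1, √(ρ ^ 2 - D x ^ 2)) ≤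
      volume (E ∩ (Icc (0 : ℝ) 1)ᶜ ×ˢ Icc (0 : ℝ) 1) := by
    have h := vol_slice_le hI (f := fun x => 2 * √(ρ ^ 2 - D x ^ 2))
      (hint.const_mul 2) (fun _ _ => by positivity)
      (hEm.inter (hI.prod hI.compl)) (fun x hx =>
        ofReal_two_mul_le_volume_Ioo_union (sqrt_nonneg _)
          (fun y hy => ⟨keyl x _ le_rfl y hy, hx, fun h => by linarith [hy.2, h.1]⟩)
          (fun y hy => ⟨keyr x _ le_rfl y hy, hx, fun h => by linarith [hy.1, h.2]⟩))
    rw [integral_const_mul] at h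
    refine h.trans_eq ?_
    rw [Measure.volume_eq_prod, ← (Measure.measurePreserving_swap (μ := (volume : Measure ℝ))
      (ν := (volume : Measure ℝ))).measure_preimage
      (hEm.inter (hI.compl.prod hI)).nullMeasurableSet]
    congr 1
    ext ⟨x, y⟩
    simp only [hE, mem_inter_iff, mem_ofPred_eq, mem_preimage, Prod.swap_prod_mk, mem_prod,
      add_comm, and_comm]
  have cornl : ENNReal.ofReal (∫ x in Ioo (-ρ) 0, 2 * √(ρ ^ 2 - x ^ 2)) ≤
      volume (E ∩ Iio (0 : ℝ) ×ˢ (Icc (0 : ℝ) 1)ᶜ) := by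
    refine vol_slice_le measurableSet_Ioo
      ((Continuous.integrableOn_Icc (by fun_prop)).mono_set Ioo_subset_Icc_self)
      (fun _ _ => by positivity) (hEm.inter (measurableSet_Iio.prod hI.compl)) (fun x hx =>
        ofReal_two_mul_le_volume_Ioo_union (sqrt_nonneg _) (fun y hy => ?_) (fun y hy => ?_))
    · rw [← sq_abs x] at hy
      exact ⟨keyl x _ (hDl x) y hy, hx.2, fun h => by linarith [hy.2, h.1]⟩
    · rw [← sq_abs x] at hy
      exact ⟨keyr x _ (hDl x) y hy, hx.2, fun h => by linarith [hy.1, h.2]⟩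
  have cornr : ENNReal.ofReal (∫ x in Ioo 1 (1 + ρ), 2 * √(ρ ^ 2 - (x - 1) ^ 2)) ≤
      volume (E ∩ Ioi (1 : ℝ) ×ˢ (Icc (0 : ℝ) 1)ᶜ) := by
    refine vol_slice_le measurableSet_Ioo
      ((Continuous.integrableOn_Icc (by fun_prop)).mono_set Ioo_subset_Icc_self)
      (fun _ _ => by positivity) (hEm.inter (measurableSet_Ioi.prod hI.compl)) (fun x hx =>
        ofReal_two_mul_le_volume_Ioo_union (sqrt_nonneg _) (fun y hy => ?_) (fun y hy => ?_))
    · rw [← sq_abs (x - 1)] at hy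
      exact ⟨keyl x _ (hDr x) y hy, hx.1, fun h => by linarith [hy.2, h.1]⟩
    · rw [← sq_abs (x - 1)] at hy
      exact ⟨keyr x _ (hDr x) y hy, hx.1, fun h => by linarith [hy.1, h.2]⟩
  have hJ0 : 0 ≤ ∫ x in Icc (0 : ℝ) 1, √(ρ ^ 2 - D x ^ 2) :=
    integral_nonneg fun _ => sqrt_nonneg _
  have hl0 : 0 ≤ ∫ x in Ioo (-ρ) 0, 2 * √(ρ ^ 2 - x ^ 2) := integral_nonneg fun _ => by positivity
  have hr0 : 0 ≤ ∫ x in Ioo 1 (1 + ρ), 2 * √(ρ ^ 2 - (x - 1) ^ 2) :=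
    integral_nonneg fun _ => by positivity
  rw [← integral_corners hρ]
  set J := ∫ x in Icc (0 : ℝ) 1, √(ρ ^ 2 - D x ^ 2)
  set L := ∫ x in Ioo (-ρ) 0, 2 * √(ρ ^ 2 - x ^ 2)
  set R := ∫ x in Ioo 1 (1 + ρ), 2 * √(ρ ^ 2 - (x - 1) ^ 2)
  rw [show 1 + 4 * J + (L + R) = ((1 + 2 * J) + 2 * J) + L + R by ring,
    ENNReal.ofReal_add (by positivity) hr0, ENNReal.ofReal_add (by positivity) hl0,
    ENNReal.ofReal_add (by positivity) (by positivity)]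
  refine (add_le_add (add_le_add (add_le_add mid side) cornl) cornr).trans ?_
  rw [← measure_union _ (hEm.inter (hI.compl.prod hI)),
    ← measure_union _ (hEm.inter (measurableSet_Iio.prod hI.compl)),
    ← measure_union _ (hEm.inter (measurableSet_Ioi.prod hI.compl))]
  · refine measure_mono ?_
    simp only [union_subset_iff, inter_subset_left, and_self]
  all_goals
    rw [Set.disjoint_left]
    rintro ⟨x, y⟩ h
    simp only [mem_union, mem_inter_iff, mem_prod, mem_univ, mem_compl_iff, mem_Icc, mem_Iio,
      mem_Ioi] at h ⊢
    grind

theorem lerp_le_sqrt {ρ σ u : ℝ} (hσ : 0 ≤ σ) (hσρ : σ ≤ ρ) (hu0 : 0 ≤ u) (hu1 : u ≤ 1) :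
    ρ - u * (ρ - σ) ≤ √(ρ ^ 2 - u ^ 2 * (ρ ^ 2 - σ ^ 2)) := by
  apply le_sqrt_of_sq_le
  nlinarith [mul_nonneg (mul_nonneg hu0 (sub_nonneg.2 hu1))
    (mul_nonneg (hσ.trans hσρ) (sub_nonneg.2 hσρ))]

/-- Lower bound for the integral of the height of a side strip, when `D` is at most the distance
to the ends of the middle gap `[1/r, 1 - 1/r]` and small off that gap. -/
theorem le_integral_strip {r : ℝ} (hr : 2 < r) {D : ℝ → ℝ} (hD : Continuous D) (hD0 : ∀ x, 0 ≤ D x)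
    (hgl : ∀ x, D x ≤ |x - 1 / r|) (hgr : ∀ x, D x ≤ |x - (1 - 1 / r)|)
    (hl : ∀ x ∈ Icc 0 (1 / r), D x ≤ (r - 2) / r / 2 / r)
    (hh : ∀ x ∈ Icc (1 - 1 / r) 1, D x ≤ (r - 2) / r / 2 / r) :
    (r - 2) / r / r * √(r ^ 2 - (1 / r) ^ 2) +
        ((r - 2) / r) ^ 2 / 4 * (r + √(r ^ 2 - 1)) ≤
      ∫ x in Icc (0 : ℝ) 1, √(((r - 2) / 2) ^ 2 - D x ^ 2) := by
  have hr0 : 0 < r := by linarith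
  have hi : 1 / r < 1 / 2 := one_div_lt_one_div_of_lt (by norm_num) hr
  have hi0 : 0 < 1 / r := by positivity
  set s := √(r ^ 2 - 1) with hs
  set q := √(r ^ 2 - (1 / r) ^ 2) with hq
  have hs2 : s ^ 2 = r ^ 2 - 1 := sq_sqrt (by nlinarith)
  have hsr : s ≤ r := by rw [hs, sqrt_le_left hr0.le]; linarith
  set δ := (r - 2) / r with hδ
  have hδ0 : 0 < δ := div_pos (by linarith) hr0
  have hρ : (r - 2) / 2 = δ * r / 2 := by rw [hδ]; field_simp
  have hδi : δ = 1 - 2 * (1 / r) := by rw [hδ]; field_simp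
  rw [hρ]
  have hfi : ∀ a b, IntervalIntegrable (fun x => √((δ * r / 2) ^ 2 - D x ^ 2)) volume a b :=
    fun a b => Continuous.intervalIntegrable (by fun_prop) _ _
  have hend : ∀ x, D x ≤ δ / 2 / r → δ / 2 * q ≤ √((δ * r / 2) ^ 2 - D x ^ 2) := by
    intro x hx
    have h1 := pow_le_pow_left₀ (hD0 x) hx 2
    rw [hq, ← sqrt_sq (show 0 ≤ δ / 2 by positivity), ← sqrt_mul (by positivity)]
    apply sqrt_le_sqrt
    have : (δ / 2 / r) ^ 2 = (δ / 2) ^ 2 * (1 / r) ^ 2 := by ring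
    nlinarith
  have hgap : ∀ x u, 0 ≤ u → u ≤ δ / 2 → D x ≤ u →
      δ / 2 * r - u * (r - s) ≤ √((δ * r / 2) ^ 2 - D x ^ 2) := by
    intro x u hu hu1 hx
    have h1 := pow_le_pow_left₀ (hD0 x) hx 2
    have h2 := lerp_le_sqrt (ρ := δ / 2 * r) (σ := δ / 2 * s) (u := u / (δ / 2))
      (by positivity) (by gcongr) (by positivity) (by rw [div_le_one (by positivity)]; exact hu1)
    refine le_trans (le_of_eq ?_) (h2.trans (sqrt_le_sqrt ?_))
    · field_simp
    · have : (u / (δ / 2)) ^ 2 * ((δ / 2 * r) ^ 2 - (δ / 2 * s) ^ 2) = u ^ 2 := by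
        rw [mul_pow, mul_pow, hs2]; field_simp; ring
      rw [this]; nlinarith
  rw [integral_Icc_eq_integral_Ioc, ← intervalIntegral.integral_of_le zero_le_one,
    ← intervalIntegral.integral_add_adjacent_intervals (hfi 0 (1 / r)) (hfi _ 1),
    ← intervalIntegral.integral_add_adjacent_intervals (hfi (1 / r) (1 / 2)) (hfi _ 1),
    ← intervalIntegral.integral_add_adjacent_intervals (hfi (1 / 2) (1 - 1 / r)) (hfi _ 1)]
  have i1 := intervalIntegral.integral_mono_on (μ := volume) hi0.le
    (intervalIntegrable_const (c := δ / 2 * q)) (hfi _ _) fun x hx => hend x (hl x hx)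
  have i4 := intervalIntegral.integral_mono_on (μ := volume) (a := 1 - 1 / r) (b := 1) (by linarith)
    (intervalIntegrable_const (c := δ / 2 * q)) (hfi _ _) fun x hx => hend x (hh x hx)
  have i2 := intervalIntegral.integral_mono_on (μ := volume) hi.le
    (f := fun x => δ / 2 * r - (x - 1 / r) * (r - s))
    (Continuous.intervalIntegrable (by fun_prop) _ _) (hfi _ _) fun x hx =>
      hgap x _ (by linarith [hx.1]) (by linarith [hx.2])
        ((hgl x).trans_eq (abs_of_nonneg (by linarith [hx.1])))
  have i3 := intervalIntegral.integral_mono_on (μ := volume) (a := 1 / 2) (b := 1 - 1 / r)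
    (by linarith) (f := fun x => δ / 2 * r - ((1 - 1 / r) - x) * (r - s))
    (Continuous.intervalIntegrable (by fun_prop) _ _) (hfi _ _) fun x hx =>
      hgap x _ (by linarith [hx.2]) (by linarith [hx.1])
        ((hgr x).trans_eq (by rw [abs_of_nonpos (by linarith [hx.2])]; ring))
  rw [intervalIntegral.integral_const, smul_eq_mul] at i1 i4
  rw [intervalIntegral.integral_sub (by simp) (Continuous.intervalIntegrable (by fun_prop) _ _),
    intervalIntegral.integral_const, intervalIntegral.integral_mul_const,
    intervalIntegral.integral_comp_sub_right (fun x => x), integral_id, smul_eq_mul] at i2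
  rw [intervalIntegral.integral_sub (by simp) (Continuous.intervalIntegrable (by fun_prop) _ _),
    intervalIntegral.integral_const, intervalIntegral.integral_mul_const,
    intervalIntegral.integral_comp_sub_left (fun x => x), integral_id, smul_eq_mul] at i3
  have e : δ / r = δ * (1 / r) := by ring
  rw [e]
  refine le_trans (le_of_eq ?_) (add_le_add i1 (add_le_add i2 (add_le_add i3 i4)))
  clear_value δ
  subst hδi
  ring

theorem cantorMap_apply_zero (r a b : ℝ) (x : EuclideanSpace ℝ (Fin 2)) :
    cantorMap r a b x 0 = x 0 / r + a := by
  simp [cantorMap, div_eq_inv_mul]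

theorem cantorMap_apply_one (r a b : ℝ) (x : EuclideanSpace ℝ (Fin 2)) :
    cantorMap r a b x 1 = x 1 / r + b := by
  simp [cantorMap, div_eq_inv_mul]

theorem dist_cantorMap {r : ℝ} (hr : 0 < r) (a b : ℝ) (x y : EuclideanSpace ℝ (Fin 2)) :
    dist (cantorMap r a b x) (cantorMap r a b y) = dist x y / r := by
  rw [cantorMap, cantorMap, dist_add_right, dist_smul₀, norm_inv, norm_of_nonneg hr.le,
    div_eq_inv_mul]

open scoped Pointwise in
theorem volume_image_cantorMap (r a b : ℝ) (A : Set (EuclideanSpace ℝ (Fin 2))) :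
    volume (cantorMap r a b '' A) = ENNReal.ofReal ((r ^ 2)⁻¹) * volume A := by
  have : cantorMap r a b '' A =
      (fun x => x + (WithLp.equiv 2 (Fin 2 → ℝ)).symm ![a, b]) '' (r⁻¹ • A) := by
    rw [← image_smul, image_image]; rfl
  rw [this, image_add_right, measure_preimage_add_right, Measure.addHaar_smul]
  simp [abs_of_nonneg, sq_nonneg]

theorem image_cantorMap_thickening_subset {r : ℝ} (hr : 0 < r) (a b ε : ℝ)
    (C : Set (EuclideanSpace ℝ (Fin 2))) :
    cantorMap r a b '' thickening (r * ε) C ⊆ thickening ε (cantorMap r a b '' C) := by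
  rintro _ ⟨x, hx, rfl⟩
  obtain ⟨z, hz, hxz⟩ := mem_thickening_iff.1 hx
  refine mem_thickening_iff.2 ⟨_, mem_image_of_mem _ hz, ?_⟩
  rwa [dist_cantorMap hr, div_lt_iff₀' hr]

namespace IsCantorDust

variable {r : ℝ} {C : Set (EuclideanSpace ℝ (Fin 2))}

theorem exists_eq_cantorMap (hC : IsCantorDust r C) {x : EuclideanSpace ℝ (Fin 2)} (hx : x ∈ C) :
    ∃ y ∈ C, ∃ a b, (a = 0 ∨ a = (r - 1) / r) ∧ (b = 0 ∨ b = (r - 1) / r) ∧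
      x = cantorMap r a b y := by
  rw [hC.2.2] at hx
  rcases hx with ((⟨y, hy, rfl⟩ | ⟨y, hy, rfl⟩) | ⟨y, hy, rfl⟩) | ⟨y, hy, rfl⟩ <;>
    exact ⟨y, hy, _, _, by simp, by simp, rfl⟩

theorem image_cantorMap_subset (hC : IsCantorDust r C) {a b : ℝ} (ha : a = 0 ∨ a = (r - 1) / r)
    (hb : b = 0 ∨ b = (r - 1) / r) : cantorMap r a b '' C ⊆ C := by
  intro x hx
  rw [hC.2.2]
  rcases ha with rfl | rfl <;> rcases hb with rfl | rfl <;> simp only [mem_union] <;> tauto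

theorem apply_mem_Icc (hr : 2 < r) (hC : IsCantorDust r C) (i : Fin 2)
    {x : EuclideanSpace ℝ (Fin 2)} (hx : x ∈ C) : x i ∈ Icc (0 : ℝ) 1 := by
  have hr0 : 0 < r := by linarith
  have hcont : ContinuousOn (fun x : EuclideanSpace ℝ (Fin 2) => x i) C :=
    Continuous.continuousOn (by fun_prop)
  have step : ∀ x ∈ C, ∃ y ∈ C, y i ≤ r * x i ∧ r * x i ≤ y i + (r - 1) := by
    intro x hx
    obtain ⟨y, hy, a, b, ha, hb, rfl⟩ := hC.exists_eq_cantorMap hx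
    refine ⟨y, hy, ?_⟩
    have h0 : 0 ≤ r - 1 := by linarith
    fin_cases i
    · simp only [Fin.zero_eta, cantorMap_apply_zero]
      rcases ha with rfl | rfl <;> field_simp <;> constructor <;> linarith
    · simp only [Fin.mk_one, cantorMap_apply_one]
      rcases hb with rfl | rfl <;> field_simp <;> constructor <;> linarith
  obtain ⟨m, hm, hmin⟩ := hC.1.exists_isMinOn hC.2.1 hcont
  obtain ⟨M, hM, hmax⟩ := hC.1.exists_isMaxOn hC.2.1 hcont
  obtain ⟨y, hy, hy1, -⟩ := step m hm
  obtain ⟨z, hz, -, hz1⟩ := step M hM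
  have h1 : m i ≤ y i := hmin hy
  have h2 : z i ≤ M i := hmax hz
  have h3 : m i ≤ x i := hmin hx
  have h4 : x i ≤ M i := hmax hx
  constructor <;> nlinarith

theorem corner_mem (hr : 2 < r) (hC : IsCantorDust r C) {p q : ℝ} (hp : p = 0 ∨ p = 1)
    (hq : q = 0 ∨ q = 1) : !₂[p, q] ∈ C := by
  have hr0 : 0 < r := by linarith
  set P : EuclideanSpace ℝ (Fin 2) := !₂[p, q]
  obtain ⟨y, hy, hd⟩ := hC.1.exists_infDist_eq_dist hC.2.1 P
  set f := cantorMap r ((r - 1) / r * p) ((r - 1) / r * q)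
  have hfP : f P = P := by
    ext i
    fin_cases i
    · simp only [Fin.zero_eta, f, cantorMap_apply_zero, P]
      simp; field_simp; ring
    · simp only [Fin.mk_one, f, cantorMap_apply_one, P]
      simp; field_simp; ring
  have hfy : f y ∈ C := hC.image_cantorMap_subset (by rcases hp with rfl | rfl <;> simp)
    (by rcases hq with rfl | rfl <;> simp) (mem_image_of_mem f hy)
  have h1 : infDist P C ≤ dist (f P) (f y) := by rw [hfP]; exact infDist_le_dist_of_mem hfy
  rw [dist_cantorMap hr0, hd, le_div_iff₀ hr0] at h1
  have h2 : dist P y = 0 := by nlinarith [dist_nonneg (x := P) (y := y)]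
  rwa [dist_eq_zero.1 h2]

theorem four_mul_volume_thickening_le (hr : 2 < r) (hC : IsCantorDust r C) {ε : ℝ}
    (hε : ε ≤ (r - 2) / r / 2) :
    ENNReal.ofReal (4 / r ^ 2) * volume (thickening (r * ε) C) ≤ volume (thickening ε C) := by
  have hr0 : 0 < r := by linarith
  set c := (r - 1) / r with hc
  have hc1 : c + 1 / r = 1 := by rw [hc]; field_simp; ring
  have hε' : 1 / r + ε ≤ 1 / 2 := by
    have : (r - 2) / r / 2 = 1 / 2 - 1 / r := by field_simp
    linarith
  set T := fun a b => thickening ε (cantorMap r a b '' C) with hT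
  have hTm : ∀ a b, MeasurableSet (T a b) := fun a b => isOpen_thickening.measurableSet
  have hTv : ∀ a b, ENNReal.ofReal ((r ^ 2)⁻¹) * volume (thickening (r * ε) C) ≤
      volume (T a b) := fun a b => by
    rw [← volume_image_cantorMap r a b]
    exact measure_mono (image_cantorMap_thickening_subset hr0 a b ε C)
  have hTC : ∀ a b, (a = 0 ∨ a = c) → (b = 0 ∨ b = c) → T a b ⊆ thickening ε C :=
    fun a b ha hb => thickening_subset_of_subset ε (hC.image_cantorMap_subset ha hb)
  have hbd : ∀ a b, ∀ x ∈ T a b, (a - ε < x 0 ∧ x 0 < a + 1 / r + ε) ∧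
      (b - ε < x 1 ∧ x 1 < b + 1 / r + ε) := by
    intro a b x hx
    obtain ⟨_, ⟨y, hy, rfl⟩, hxy⟩ := mem_thickening_iff.1 hx
    have hd : ∀ i, |x i - cantorMap r a b y i| < ε := fun i =>
      (by simpa [dist_eq_norm] using PiLp.norm_apply_le (x - cantorMap r a b y) i :
        |x i - cantorMap r a b y i| ≤ dist x (cantorMap r a b y)).trans_lt hxy
    have hy' : ∀ i, 0 ≤ y i / r ∧ y i / r ≤ 1 / r := fun i =>
      ⟨div_nonneg (hC.apply_mem_Icc hr i hy).1 hr0.le,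
        div_le_div_of_nonneg_right (hC.apply_mem_Icc hr i hy).2 hr0.le⟩
    have h0 := abs_lt.1 (hd 0)
    have h1 := abs_lt.1 (hd 1)
    rw [cantorMap_apply_zero] at h0
    rw [cantorMap_apply_one] at h1
    have := hy' 0
    have := hy' 1
    refine ⟨⟨?_, ?_⟩, ?_, ?_⟩ <;> linarith
  have hsum : volume (T 0 0) + volume (T c 0) + volume (T c c) + volume (T 0 c) ≤
      volume (thickening ε C) := by
    rw [← measure_union _ (hTm _ _), ← measure_union _ (hTm _ _), ← measure_union _ (hTm _ _)]
    · refine measure_mono ?_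
      simp [union_subset_iff, hTC]
    all_goals
      rw [Set.disjoint_left]
      intro x h h'
      first
      | rcases h with (h | h) | h <;> grind
      | rcases h with h | h <;> grind
      | grind
  refine le_trans ?_ hsum
  refine le_trans (le_of_eq ?_) (add_le_add (add_le_add (add_le_add (hTv _ _) (hTv _ _))
    (hTv _ _)) (hTv _ _))
  rw [div_eq_mul_inv, ENNReal.ofReal_mul (by norm_num)]
  norm_num
  ring

theorem pow_mul_volume_thickening_le (hr : 2 < r) (hC : IsCantorDust r C) (n : ℕ) :
    ENNReal.ofReal ((4 / r ^ 2) ^ n) * volume (thickening ((r - 2) / 2) C) ≤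
      volume (thickening ((r - 2) / 2 / r ^ n) C) := by
  have hr0 : 0 < r := by linarith
  induction n with
  | zero => simp
  | succ n ih =>
    have h := hC.four_mul_volume_thickening_le hr (ε := (r - 2) / 2 / r ^ (n + 1)) (by
      rw [div_div, div_div]
      apply div_le_div_of_nonneg_left (by linarith) (by positivity)
      have := one_le_pow₀ (n := n) (show 1 ≤ r by linarith)
      rw [pow_succ]; nlinarith)
    rw [show r * ((r - 2) / 2 / r ^ (n + 1)) = (r - 2) / 2 / r ^ n by
      rw [pow_succ]; field_simp] at h
    refine le_trans ?_ h
    rw [pow_succ', ENNReal.ofReal_mul (by positivity), mul_assoc]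
    gcongr

end IsCantorDust

/-- Endpoints of the intervals of the `n`-th stage of the Cantor set of ratio `1 / r`. -/
def cantorEndpoints (r : ℝ) : ℕ → Set ℝ
  | 0 => {0, 1}
  | n + 1 => (fun t => t / r + 0) '' cantorEndpoints r n ∪
      (fun t => t / r + (r - 1) / r) '' cantorEndpoints r n

theorem finite_cantorEndpoints (r : ℝ) (n : ℕ) : (cantorEndpoints r n).Finite := by
  induction n with
  | zero => exact (finite_singleton _).insert _
  | succ n ih => exact (ih.image _).union (ih.image _)

theorem zero_mem_cantorEndpoints (r : ℝ) (n : ℕ) : 0 ∈ cantorEndpoints r n := by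
  induction n with
  | zero => exact Or.inl rfl
  | succ n ih => exact Or.inl ⟨0, ih, by simp⟩

theorem one_mem_cantorEndpoints {r : ℝ} (hr : r ≠ 0) (n : ℕ) : 1 ∈ cantorEndpoints r n := by
  induction n with
  | zero => exact Or.inr rfl
  | succ n ih => exact Or.inr ⟨1, ih, by field_simp; ring⟩

theorem exists_mem_cantorEndpoints_abs_sub_le {r : ℝ} (hr : 2 < r) (n : ℕ) {x : ℝ}
    (hx : x ∈ Icc (0 : ℝ) 1) :
    ∃ k ∈ cantorEndpoints r n, |x - k| ≤ max ((r - 2) / r / 2) ((r ^ n)⁻¹) := by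
  have hr0 : 0 < r := by linarith
  have hδ0 : 0 ≤ (r - 2) / r / 2 := div_nonneg (div_nonneg (by linarith) hr0.le) (by norm_num)
  have hδ : (r - 2) / r / 2 = 1 / 2 - 1 / r := by field_simp
  induction n generalizing x with
  | zero => exact ⟨0, Or.inl rfl, le_max_of_le_right (by simp [abs_of_nonneg hx.1, hx.2])⟩
  | succ n ih =>
    have hmax : max ((r - 2) / r / 2) ((r ^ n)⁻¹) / r ≤
        max ((r - 2) / r / 2) ((r ^ (n + 1))⁻¹) := by
      rw [← max_div_div_right hr0.le]
      refine max_le_max (div_le_self hδ0 (by linarith)) (le_of_eq ?_)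
      rw [pow_succ, mul_inv, div_eq_mul_inv]
    have hsc : ∀ c k : ℝ, x - (k / r + c) = (r * (x - c) - k) / r := fun c k => by field_simp; ring
    rcases le_total x (1 / r) with h | h
    · obtain ⟨k, hk, hxk⟩ := ih (x := r * (x - 0))
        ⟨by nlinarith [hx.1], by rw [sub_zero]; exact (le_div_iff₀' hr0).1 h⟩
      refine ⟨_, Or.inl ⟨k, hk, rfl⟩, ?_⟩
      simp only []
      rw [hsc, abs_div, abs_of_pos hr0]
      exact (div_le_div_of_nonneg_right hxk hr0.le).trans hmax
    rcases le_total ((r - 1) / r) x with h' | h'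
    · have e : r * (x - (r - 1) / r) = r * x - (r - 1) := by field_simp
      obtain ⟨k, hk, hxk⟩ := ih (x := r * (x - (r - 1) / r))
        ⟨mul_nonneg hr0.le (sub_nonneg.2 h'), by rw [e]; nlinarith [hx.2]⟩
      refine ⟨_, Or.inr ⟨k, hk, rfl⟩, ?_⟩
      simp only []
      rw [hsc, abs_div, abs_of_pos hr0]
      exact (div_le_div_of_nonneg_right hxk hr0.le).trans hmax
    have hc : (r - 1) / r = 1 - 1 / r := by field_simp
    rcases le_total x (1 / 2) with h2 | h2
    · exact ⟨_, Or.inl ⟨1, one_mem_cantorEndpoints hr0.ne' n, rfl⟩, le_max_of_le_left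
        (abs_le.2 ⟨by simp only []; linarith, by simp only []; linarith⟩)⟩
    · exact ⟨_, Or.inr ⟨0, zero_mem_cantorEndpoints r n, rfl⟩, le_max_of_le_left
        (abs_le.2 ⟨by simp only []; rw [zero_div]; linarith, by simp only []; rw [zero_div]; linarith⟩)⟩

theorem IsCantorDust.cantorEndpoints_mem {r : ℝ} (hr : 2 < r) {C : Set (EuclideanSpace ℝ (Fin 2))}
    (hC : IsCantorDust r C) (n : ℕ) {a b : ℝ} (ha : a ∈ cantorEndpoints r n)
    (hb : b ∈ cantorEndpoints r n) : !₂[a, b] ∈ C := by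
  induction n generalizing a b with
  | zero => exact hC.corner_mem hr ha hb
  | succ n ih =>
    have key : ∀ s t u v, s ∈ cantorEndpoints r n → t ∈ cantorEndpoints r n →
        (u = 0 ∨ u = (r - 1) / r) → (v = 0 ∨ v = (r - 1) / r) →
        !₂[s / r + u, t / r + v] ∈ C := by
      intro s t u v hs ht hu hv
      convert hC.image_cantorMap_subset hu hv (mem_image_of_mem _ (ih hs ht)) using 1
      ext i
      fin_cases i
      · simp [cantorMap_apply_zero]
      · simp [cantorMap_apply_one]
    rcases ha with ⟨s, hs, rfl⟩ | ⟨s, hs, rfl⟩ <;> rcases hb with ⟨t, ht, rfl⟩ | ⟨t, ht, rfl⟩ <;>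
      exact key _ _ _ _ hs ht (by simp) (by simp)

theorem numerator_lt {r J : ℝ} (hr : 2 < r)
    (hJ : (r - 2) / r / r * √(r ^ 2 - (1 / r) ^ 2) +
        ((r - 2) / r) ^ 2 / 4 * (r + √(r ^ 2 - 1)) ≤ J) :
    1 + 2 * ((r - 2) / r) * √(r ^ 2 - 1) + 3 * ((r - 2) / r) -
        3 / r * ((r - 2) / r) * √(r ^ 2 - 1) +
        ((r - 2) / r) ^ 2 * (r - √(r ^ 2 - 1) + r ^ 2 * π / 4) <
      1 + 4 * J + π * ((r - 2) / 2) ^ 2 := by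
  have hr0 : 0 < r := by linarith
  have h := three_mul_add_sqrt_lt hr
  have hδ0 : 0 < (r - 2) / r := div_pos (by linarith) hr0
  set s := √(r ^ 2 - 1)
  set q := √(r ^ 2 - (1 / r) ^ 2)
  have h2 := mul_lt_mul_of_pos_left h (div_pos hδ0 hr0)
  have e : 1 + 4 * ((r - 2) / r / r * q + ((r - 2) / r) ^ 2 / 4 * (r + s)) + π * ((r - 2) / 2) ^ 2 -
      (1 + 2 * ((r - 2) / r) * s + 3 * ((r - 2) / r) - 3 / r * ((r - 2) / r) * s +
        ((r - 2) / r) ^ 2 * (r - s + r ^ 2 * π / 4)) =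
      (r - 2) / r / r * (4 * q) - (r - 2) / r / r * (3 * r + s) := by
    field_simp
    ring
  linarith

theorem IsCantorDust.exists_lt_volume_thickening {r : ℝ} (hr : 2 < r)
    {C : Set (EuclideanSpace ℝ (Fin 2))} (hC : IsCantorDust r C) :
    ∃ X, 1 + 2 * ((r - 2) / r) * √(r ^ 2 - 1) + 3 * ((r - 2) / r) -
        3 / r * ((r - 2) / r) * √(r ^ 2 - 1) +
        ((r - 2) / r) ^ 2 * (r - √(r ^ 2 - 1) + r ^ 2 * π / 4) < X ∧
      0 ≤ X ∧ ENNReal.ofReal X ≤ volume (thickening ((r - 2) / 2) C) := by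
  have hr0 : 0 < r := by linarith
  have hδ0 : 0 < (r - 2) / r / 2 := div_pos (div_pos (by linarith) hr0) (by norm_num)
  obtain ⟨N, hN⟩ := exists_pow_lt_of_lt_one hδ0 (inv_lt_one_of_one_lt₀ (by linarith : 1 < r))
  rw [inv_pow] at hN
  have hi0 : 0 < 1 / r := by positivity
  have hi1 : 1 / r < 1 := by rw [div_lt_one hr0]; linarith
  have happrox : ∀ x ∈ Icc (0 : ℝ) 1, ∃ k ∈ cantorEndpoints r N, |x - k| ≤ (r - 2) / r / 2 :=
    fun x hx => by
      simpa only [max_eq_left hN.le] using exists_mem_cantorEndpoints_abs_sub_le hr N hx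
  have happrox' : ∀ x ∈ Icc (0 : ℝ) 1,
      ∃ k ∈ cantorEndpoints r (N + 1), |x - k| ≤ (r - 2) / r / 2 := fun x hx => by
    have hle : (r ^ (N + 1))⁻¹ ≤ (r - 2) / r / 2 :=
      (inv_anti₀ (by positivity) (pow_le_pow_right₀ (by linarith) N.le_succ)).trans hN.le
    simpa only [max_eq_left hle] using exists_mem_cantorEndpoints_abs_sub_le hr (N + 1) hx
  set K := cantorEndpoints r (N + 1) with hK
  have hKne : K.Nonempty := ⟨0, zero_mem_cantorEndpoints r _⟩
  set D : ℝ → ℝ := fun x => infDist x K with hD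
  have hDle : ∀ x, ∀ k ∈ K, D x ≤ |x - k| := fun x k hk => infDist_le_dist_of_mem hk
  have hDc : Continuous D := continuous_infDist_pt K
  have hD0 : ∀ x, 0 ≤ D x := fun x => infDist_nonneg
  have hsc : ∀ x c k t : ℝ, t = k / r + c → x - t = (r * (x - c) - k) / r :=
    fun x c k t h => by rw [h]; field_simp; ring
  have hc : (r - 1) / r = 1 - 1 / r := by field_simp
  have hfine : ∀ x c, (c = 0 ∨ c = (r - 1) / r) → x - c ∈ Icc 0 (1 / r) →
      D x ≤ (r - 2) / r / 2 / r := by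
    intro x c hc hx
    obtain ⟨k, hk, hxk⟩ := happrox (r * (x - c))
      ⟨mul_nonneg hr0.le hx.1, (le_div_iff₀' hr0).1 hx.2⟩
    have hmem : k / r + c ∈ K := by
      rcases hc with rfl | rfl
      · exact Or.inl ⟨k, hk, rfl⟩
      · exact Or.inr ⟨k, hk, rfl⟩
    refine (hDle x _ hmem).trans ?_
    rw [hsc x c k _ rfl, abs_div, abs_of_pos hr0]
    exact div_le_div_of_nonneg_right hxk hr0.le
  have hJ := le_integral_strip hr hDc hD0
    (fun x => hDle x _ (Or.inl ⟨1, one_mem_cantorEndpoints hr0.ne' N, by simp⟩))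
    (fun x => hDle x _ (Or.inr ⟨0, zero_mem_cantorEndpoints r N, by rw [← hc]; simp⟩))
    (fun x hx => hfine x 0 (Or.inl rfl) (by rwa [sub_zero]))
    (fun x hx => hfine x _ (Or.inr rfl) (by
      rw [hc]; exact ⟨by linarith [hx.1], by linarith [hx.2]⟩))
  have hJ0 : 0 ≤ ∫ x in Icc (0 : ℝ) 1, √(((r - 2) / 2) ^ 2 - D x ^ 2) :=
    integral_nonneg fun _ => sqrt_nonneg _
  refine ⟨_, numerator_lt hr hJ, by positivity, ?_⟩
  refine (area_le_volume_sublevel hDc hD0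
    (fun x => (hDle x 0 (zero_mem_cantorEndpoints r _)).trans_eq (by rw [sub_zero]))
    (fun x => hDle x 1 (one_mem_cantorEndpoints hr0.ne' _)) (by linarith)
    (η := (r - 2) / r / 2) ?_ fun x hx => ?_).trans ?_
  · rw [show (r - 2) / 2 = (r - 2) / r / 2 * r by field_simp, mul_pow, mul_comm]
    exact mul_lt_mul_of_pos_left (by nlinarith) (by positivity)
  · obtain ⟨k, hk, hxk⟩ := happrox' x hx
    exact (hDle x k hk).trans hxk
  rw [← measurePreserving_coords.measure_preimage
    (isOpen_lt (by fun_prop) (by fun_prop)).measurableSet.nullMeasurableSet]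
  refine measure_mono fun x hx => ?_
  have hKc : IsCompact K := (finite_cantorEndpoints r _).isCompact
  obtain ⟨k, hk, hxk⟩ := hKc.exists_infDist_eq_dist hKne (x 0)
  obtain ⟨l, hl, hxl⟩ := hKc.exists_infDist_eq_dist hKne (x 1)
  refine mem_thickening_iff.2 ⟨_, hC.cantorEndpoints_mem hr _ hk hl, ?_⟩
  rw [EuclideanSpace.dist_eq, sqrt_lt' (by linarith)]
  simpa [hD, hxk, hxl] using hx

theorem rpow_two_sub_logb_four {r x : ℝ} (hr : 2 < r) (hx : 0 < x) (n : ℕ) :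
    (x / r ^ n) ^ (2 - Real.log 4 / Real.log r) =
      x ^ (2 - Real.log 4 / Real.log r) * (4 / r ^ 2) ^ n := by
  have hr0 : 0 < r := by linarith
  have hlog : Real.log r ≠ 0 := (Real.log_pos (by linarith)).ne'
  have h4 : r ^ (Real.log 4 / Real.log r) = 4 := by
    rw [Real.rpow_def_of_pos hr0, mul_div_cancel₀ _ hlog, Real.exp_log (by norm_num)]
  rw [Real.div_rpow hx.le (by positivity), ← Real.rpow_natCast r n, ← Real.rpow_mul hr0.le,
    mul_comm (n : ℝ), Real.rpow_mul hr0.le, Real.rpow_sub hr0, h4, Real.rpow_natCast, Real.rpow_two, div_eq_mul_inv,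
    ← inv_pow, inv_div]

/-- For `r > 2` and every integer `n ≥ 1`, with `ε = (1/2)·((r-2)/r)·r^(-(n-1))`, one has
`λ²((C^r)_ε) / ε^(2 - D_r) > f₁(r)`, where `D_r = log 4 / log r`. -/
theorem stmt_9 (r : ℝ) (hr : 2 < r) (C : Set (EuclideanSpace ℝ (Fin 2)))
    (hC : IsCantorDust r C) (n : ℕ) (hn : 1 ≤ n) :
    f₁ r <
      (volume (cthickening (1 / 2 * ((r - 2) / r) * r ^ (-((n : ℝ) - 1))) C)).toReal /
        (1 / 2 * ((r - 2) / r) * r ^ (-((n : ℝ) - 1))) ^ (2 - Real.log 4 / Real.log r) := by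
  have hr0 : 0 < r := by linarith
  have hr2 : 0 < r - 2 := by linarith
  obtain ⟨X, hX, hX0, hXv⟩ := hC.exists_lt_volume_thickening hr
  have hε : 1 / 2 * ((r - 2) / r) * r ^ (-((n : ℝ) - 1)) = (r - 2) / 2 / r ^ n := by
    rw [neg_sub, Real.rpow_sub hr0, Real.rpow_one, Real.rpow_natCast]
    field_simp
  have hρ : 0 < ((r - 2) / 2) ^ (2 - Real.log 4 / Real.log r) := by positivity
  have hden : 1 / 4 * (r - 2) ^ 2 * (1 / 2 : ℝ) ^ (-(Real.log 4 / Real.log r)) *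
      (r - 2) ^ (-(Real.log 4 / Real.log r)) = ((r - 2) / 2) ^ (2 - Real.log 4 / Real.log r) := by
    rw [mul_assoc, ← Real.mul_rpow (by norm_num) hr2.le, sub_eq_add_neg (2 : ℝ),
      Real.rpow_add (by positivity), Real.rpow_two, one_div_mul_eq_div]
    ring_nf
  have hfin : volume (cthickening ((r - 2) / 2 / r ^ n) C) ≠ ∞ :=
    hC.1.isBounded.cthickening.measure_lt_top.ne
  have hle : (4 / r ^ 2) ^ n * X ≤ (volume (cthickening ((r - 2) / 2 / r ^ n) C)).toReal := by
    rw [← ENNReal.ofReal_le_iff_le_toReal hfin, ENNReal.ofReal_mul (by positivity)]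
    exact (mul_le_mul_right hXv _).trans ((hC.pow_mul_volume_thickening_le hr n).trans
      (measure_mono (thickening_subset_cthickening _ _)))
  rw [f₁, hden, hε, rpow_two_sub_logb_four hr (by positivity)]
  calc _ < X / ((r - 2) / 2) ^ (2 - Real.log 4 / Real.log r) := div_lt_div_of_pos_right hX hρ
    _ = (4 / r ^ 2) ^ n * X /
        (((r - 2) / 2) ^ (2 - Real.log 4 / Real.log r) * (4 / r ^ 2) ^ n) := by field_simp
    _ ≤ _ := div_le_div_of_nonneg_right hle (by positivity)
end

section
/- (Gatzouras) Let N ≥ 2 and let S₁, …, S_N : ℝ^d → ℝ^d be contracting similarities with scaling ratios r₁, …, r_N ∈ (0,1), i.e. ‖S_i(x) − S_i(y)‖ = r_i·‖x − y‖ for all x, y. Assume the open set condition: there exists a nonempty bounded open set O ⊆ ℝ^d such that the images S₁(O), …, S_N(O) are pairwise disjoint and contained in O. Let F be the attractor, i.e. the unique nonempty compact set with F = S₁(F) ∪ … ∪ S_N(F), and let D be the unique real number with r₁^D + … + r_N^D = 1. Assume the system is non-lattice: the additive subgroup of ℝ generated by {log r₁, …, log r_N} is not of the form a·ℤ for any a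 > 0 (equivalently, it is dense in ℝ). Then F is Minkowski measurable: lim_{ε→0⁺} λ^d(F_ε)/ε^(d−D) exists and lies in (0, ∞). -/
open MeasureTheory Metric Set Real Filter Topology

/-- A function that dominates its weighted backward averages stays above any lower bound it has on
one window that is long enough. -/
lemma le_of_le_on_window {ι : Type*} [Fintype ι] {p c : ι → ℝ} (hp : ∀ i, 0 ≤ p i)
    (hsum : ∑ i, p i = 1) {a b : ℝ} (ha : 0 < a) (hac : ∀ i, a ≤ c i) (hcb : ∀ i, c i ≤ b)
    {f : ℝ → ℝ} {T m : ℝ} (hf : ∀ t, T ≤ t → ∑ i, p i * f (t - c i) ≤ f t)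
    (hw : ∀ t, T - b ≤ t → t ≤ T → m ≤ f t) {t : ℝ} (ht : T - b ≤ t) : m ≤ f t := by
  have key : ∀ n : ℕ, ∀ t, T - b ≤ t → t ≤ T + n * a → m ≤ f t := by
    intro n
    induction n with
    | zero => intro t h1 h2; exact hw t h1 (by simpa using h2)
    | succ n ih =>
      intro t h1 h2
      rcases le_total t T with h | h
      · exact hw t h1 h
      · calc m = ∑ i, p i * m := by rw [← Finset.sum_mul, hsum, one_mul]
          _ ≤ ∑ i, p i * f (t - c i) := by
            refine Finset.sum_le_sum fun i _ => mul_le_mul_of_nonneg_left ?_ (hp i)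
            refine ih _ (by linarith [hcb i]) ?_
            push_cast at h2
            linarith [hac i]
          _ ≤ f t := hf t h
  obtain ⟨n, hn⟩ := exists_nat_ge ((t - T) / a)
  refine key n t ht ?_
  rw [div_le_iff₀ ha] at hn
  linarith

/-- A non-lattice family of positive numbers generates an additive monoid that is asymptotically
dense in `[0, ∞)`. -/
lemma exists_mem_closure_near_of_nonlattice {ι : Type*} [Nonempty ι] {c : ι → ℝ}
    (hc : ∀ i, 0 < c i) (hnl : ¬ ∃ a : ℝ, 0 < a ∧ ∀ i, ∃ k : ℤ, c i = a * k) {δ : ℝ}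
    (hδ : 0 < δ) :
    ∃ x₀ : ℝ, ∀ x, x₀ ≤ x → ∃ s ∈ AddSubmonoid.closure (range c), s ≤ x ∧ x ≤ s + δ := by
  set M := AddSubmonoid.closure (range c)
  set G := AddSubgroup.closure (range c) with hG
  have hdense : Dense (G : Set ℝ) := by
    rcases AddSubgroup.dense_or_cyclic G with h | ⟨a, ha⟩
    · exact h
    · exfalso
      have hk : ∀ i, ∃ k : ℤ, k • a = c i := fun i => by
        rw [← AddSubgroup.mem_closure_singleton, ← ha]
        exact AddSubgroup.subset_closure ⟨i, rfl⟩
      have ha0 : a ≠ 0 := by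
        rintro rfl
        obtain ⟨k, hk⟩ := hk (Classical.arbitrary ι)
        have := hc (Classical.arbitrary ι)
        simp at hk
        linarith
      refine hnl ⟨|a|, abs_pos.2 ha0, fun i => ?_⟩
      obtain ⟨k, hk⟩ := hk i
      rcases abs_cases a with ⟨h, -⟩ | ⟨h, -⟩
      · exact ⟨k, by rw [h, ← hk, zsmul_eq_mul, mul_comm]⟩
      · exact ⟨-k, by rw [h, ← hk, zsmul_eq_mul]; push_cast; ring⟩
  have hdiff : ∀ g ∈ G, ∃ a ∈ M, ∃ b ∈ M, g = a - b := by
    intro g hg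
    induction hg using AddSubgroup.closure_induction with
    | mem x hx => exact ⟨x, AddSubmonoid.subset_closure hx, 0, M.zero_mem, by simp⟩
    | zero => exact ⟨0, M.zero_mem, 0, M.zero_mem, by simp⟩
    | add x y _ _ hx hy =>
      obtain ⟨a, ha, b, hb, rfl⟩ := hx
      obtain ⟨a', ha', b', hb', rfl⟩ := hy
      exact ⟨a + a', M.add_mem ha ha', b + b', M.add_mem hb hb', by ring⟩
    | neg x _ hx =>
      obtain ⟨a, ha, b, hb, rfl⟩ := hx
      exact ⟨b, hb, a, ha, by ring⟩
  have hnonneg : ∀ s ∈ M, 0 ≤ s := by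
    intro s hs
    induction hs using AddSubmonoid.closure_induction with
    | mem x hx => obtain ⟨i, rfl⟩ := hx; exact (hc i).le
    | zero => exact le_rfl
    | add x y _ _ hx hy => exact add_nonneg hx hy
  obtain ⟨g, hgG, hg0, hgδ⟩ := hdense.exists_between hδ
  obtain ⟨a, b, haM, hbM, hb, hgab⟩ : ∃ a b, a ∈ M ∧ b ∈ M ∧ 0 < b ∧ a = b + g := by
    obtain ⟨a, ha, b, hb, h⟩ := hdiff g hgG
    let i := Classical.arbitrary ι
    have hi : c i ∈ M := AddSubmonoid.subset_closure ⟨i, rfl⟩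
    exact ⟨a + c i, b + c i, M.add_mem ha hi, M.add_mem hb hi,
      add_pos_of_nonneg_of_pos (hnonneg b hb) (hc i), by rw [h]; ring⟩
  obtain ⟨n, hn⟩ := exists_nat_ge (b / g)
  rw [div_le_iff₀ hg0] at hn
  refine ⟨n * b, fun x hx => ?_⟩
  have hx0 : 0 ≤ x := le_trans (by positivity) hx
  set m := ⌊x / b⌋₊
  have hm1 : m * b ≤ x := (le_div_iff₀ hb).1 (Nat.floor_le (by positivity))
  have hm2 : x < (m + 1) * b := (div_lt_iff₀ hb).1 (Nat.lt_floor_add_one _)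
  have hnm : (n : ℝ) ≤ m := by
    exact_mod_cast Nat.le_floor ((le_div_iff₀ hb).2 hx)
  set k := ⌊(x - m * b) / g⌋₊
  have hk0 : 0 ≤ (x - m * b) / g := div_nonneg (by linarith) hg0.le
  have hk1 : k * g ≤ x - m * b := (le_div_iff₀ hg0).1 (Nat.floor_le hk0)
  have hk2 : x - m * b < (k + 1) * g := (div_lt_iff₀ hg0).1 (Nat.lt_floor_add_one _)
  have hkm : k ≤ m := by
    have h1 : (n : ℝ) * g ≤ m * g := mul_le_mul_of_nonneg_right hnm hg0.le
    have h2 : (k : ℝ) * g < m * g := by nlinarith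
    exact_mod_cast (lt_of_mul_lt_mul_right h2 hg0.le).le
  refine ⟨(m - k : ℕ) • b + k • a, M.add_mem (M.nsmul_mem hbM _) (M.nsmul_mem haM _), ?_⟩
  rw [nsmul_eq_mul, nsmul_eq_mul, Nat.cast_sub hkm, hgab]
  constructor <;> nlinarith

/-- Convergence of slowly decreasing solutions of a non-lattice renewal equation whose error term
decays exponentially. -/
theorem tendsto_of_renewal {ι : Type*} [Fintype ι] [Nonempty ι] {p c : ι → ℝ}
    (hp : ∀ i, 0 < p i) (hsum : ∑ i, p i = 1) (hc : ∀ i, 0 < c i)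
    (hnl : ¬ ∃ a : ℝ, 0 < a ∧ ∀ i, ∃ k : ℤ, c i = a * k) {Z : ℝ → ℝ} {κ C δ T₀ : ℝ}
    (hδ : 0 < δ) (hC : 0 ≤ C) (hκ : 0 ≤ κ) (hZ : ∀ t, 0 ≤ Z t)
    (hslow : ∀ t u, 0 ≤ u → exp (-(κ * u)) * Z t ≤ Z (t - u))
    (hsub : ∀ t, Z t ≤ ∑ i, p i * Z (t - c i))
    (hsuper : ∀ t, T₀ ≤ t → ∑ i, p i * Z (t - c i) - C * exp (-(δ * t)) ≤ Z t) :
    ∃ L, Tendsto Z atTop (𝓝 L) := by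
  obtain ⟨i₀, hi₀⟩ := Finite.exists_min c
  obtain ⟨i₁, hi₁⟩ := Finite.exists_max c
  set a := c i₀
  set b := c i₁
  have ha : 0 < a := hc i₀
  have hb : 0 < b := hc i₁
  have hbdd : ∃ B, ∀ t, -b ≤ t → Z t ≤ B := by
    refine ⟨exp (κ * b) * Z (-b), fun t ht => ?_⟩
    have := le_of_le_on_window (f := fun t => -Z t) (T := 0) (m := -(exp (κ * b) * Z (-b)))
      (fun i => (hp i).le) hsum ha hi₀ hi₁
      (fun t _ => by simpa using hsub t) ?_ (t := t) (by linarith)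
    · linarith
    · intro t h1 h2
      have h := hslow t (t + b) (by linarith)
      rw [exp_neg, inv_mul_le_iff₀ (exp_pos _)] at h
      have h3 : exp (κ * (t + b)) ≤ exp (κ * b) := by gcongr; linarith
      have h4 := mul_le_mul_of_nonneg_right h3 (hZ (-b))
      rw [show t - (t + b) = -b by ring] at h
      linarith
  obtain ⟨B, hB⟩ := hbdd
  have hup : IsBoundedUnder (· ≤ ·) atTop Z :=
    ⟨B, by rw [eventually_map]; filter_upwards [eventually_ge_atTop (-b)] with t ht using hB t ht⟩
  have hlow : IsBoundedUnder (· ≥ ·) atTop Z :=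
    ⟨0, by rw [eventually_map]; exact Eventually.of_forall hZ⟩
  set M := limsup Z atTop with hM
  have hlt : ∀ η > 0, ∀ᶠ t in atTop, Z t < M + η := fun η hη =>
    eventually_lt_of_limsup_lt (by linarith) hup
  have hfreq : ∀ η > 0, ∃ᶠ t in atTop, M - η < Z t := fun η hη =>
    frequently_lt_of_lt_limsup hlow.isCoboundedUnder_le (by linarith)
  let l : Filter ℝ := atTop ⊓ comap Z (𝓝 M)
  have hl : l.NeBot := by
    have h : MapClusterPt M atTop Z := by
      rw [mapClusterPt_iff_frequently]
      intro s hs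
      obtain ⟨η, hη, hs⟩ := Metric.mem_nhds_iff.1 hs
      refine ((hfreq η hη).and_eventually (hlt η hη)).mono fun t ht => hs ?_
      rw [mem_ball, Real.dist_eq, abs_lt]
      constructor <;> linarith [ht.1, ht.2]
    refine (map_neBot_iff Z).1 ?_
    change (map Z (atTop ⊓ comap Z (𝓝 M))).NeBot
    rw [Filter.push_pull, inf_comm]
    exact h
  have hl_top : l ≤ atTop := inf_le_left
  have hnear : ∀ s ∈ AddSubmonoid.closure (range c), ∀ η > 0, ∀ᶠ t in l, M - η < Z (t - s) := by
    intro s hs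
    induction hs using AddSubmonoid.closure_induction_right with
    | zero =>
      intro η hη
      have : Tendsto Z l (𝓝 M) := tendsto_comap.mono_left inf_le_right
      simpa using this.eventually (lt_mem_nhds (show M - η < M by linarith))
    | add_right s hs x hx ih =>
      obtain ⟨i, rfl⟩ := hx
      intro η hη
      have hη' : 0 < p i * η / 2 := by have := hp i; positivity
      have h2 : ∀ᶠ t in l, ∀ j, Z (t - s - c j) < M + p i * η / 2 := by
        refine hl_top (eventually_all.2 fun j => ?_)
        have : Tendsto (fun t : ℝ => t - s - c j) atTop atTop := by
          simp only [sub_eq_add_neg]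
          exact tendsto_atTop_add_const_right _ _ (tendsto_atTop_add_const_right _ _ tendsto_id)
        exact this.eventually (hlt _ hη')
      filter_upwards [ih _ hη', h2] with t h3 h4
      classical
      have h5 := hsub (t - s)
      rw [← Finset.add_sum_erase _ _ (Finset.mem_univ i)] at h5 hsum
      have h6 : ∑ j ∈ Finset.univ.erase i, p j * Z (t - s - c j) ≤
          (∑ j ∈ Finset.univ.erase i, p j) * (M + p i * η / 2) := by
        rw [Finset.sum_mul]
        exact Finset.sum_le_sum fun j _ => mul_le_mul_of_nonneg_left (h4 j).le (hp j).le
      rw [show ∑ j ∈ Finset.univ.erase i, p j = 1 - p i by linarith] at h6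
      rw [show t - (s + c i) = t - s - c i by ring]
      have h7 : p i * (M - η) < p i * Z (t - s - c i) := by
        nlinarith [mul_pos (hp i) hη', hp i]
      exact lt_of_mul_lt_mul_left h7 (hp i).le
  -- the error term is absorbed into a correction of `Z`
  have hq : 0 < ∑ i, p i * exp (δ * c i) - 1 := by
    rw [← hsum, ← Finset.sum_sub_distrib]
    refine Finset.sum_pos (fun i _ => ?_) Finset.univ_nonempty
    have : 1 < exp (δ * c i) := one_lt_exp_iff.2 (mul_pos hδ (hc i))
    nlinarith [hp i]
  set K := C / (∑ i, p i * exp (δ * c i) - 1) with hK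
  have hK0 : 0 ≤ K := div_nonneg hC hq.le
  have hKq : K * (∑ i, p i * exp (δ * c i) - 1) = C := div_mul_cancel₀ _ hq.ne'
  set Y : ℝ → ℝ := fun t => Z t - K * exp (-(δ * t)) with hY
  have hYsuper : ∀ t, T₀ ≤ t → ∑ i, p i * Y (t - c i) ≤ Y t := by
    intro t ht
    have h1 : ∑ i, p i * Y (t - c i) =
        ∑ i, p i * Z (t - c i) - K * exp (-(δ * t)) * ∑ i, p i * exp (δ * c i) := by
      rw [Finset.mul_sum, ← Finset.sum_sub_distrib]
      refine Finset.sum_congr rfl fun i _ => ?_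
      simp only [hY]
      rw [show -(δ * (t - c i)) = -(δ * t) + δ * c i by ring, exp_add]
      ring
    have h2 := hsuper t ht
    rw [h1, ← hKq] at *
    simp only [hY]
    nlinarith
  refine ⟨M, ?_⟩
  rw [tendsto_order]
  refine ⟨fun m hm => ?_, fun m hm => by simpa using hlt (m - M) (by linarith)⟩
  obtain ⟨x, hx, hx0⟩ : ∃ x : ℝ, m < exp (-(κ * (2 * x))) * (M - x) - x ∧ 0 < x := by
    have : Tendsto (fun x : ℝ => exp (-(κ * (2 * x))) * (M - x) - x) (𝓝[>] 0) (𝓝 M) := by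
      have h : Continuous fun x : ℝ => exp (-(κ * (2 * x))) * (M - x) - x := by fun_prop
      simpa using (h.tendsto 0).mono_left nhdsWithin_le_nhds
    exact ((this.eventually (lt_mem_nhds hm)).and self_mem_nhdsWithin).exists
  obtain ⟨x₀, hx₀⟩ := exists_mem_closure_near_of_nonlattice hc hnl hx0
  have hx₁ : ∀ k : ℕ, ∃ s ∈ AddSubmonoid.closure (range c),
      s ≤ x₀ + k * x ∧ x₀ + k * x ≤ s + x := fun k => hx₀ _ (by
        have : 0 ≤ (k : ℝ) * x := by positivity
        linarith)
  choose s hsM hs1 hs2 using hx₁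
  obtain ⟨n, hn⟩ := exists_nat_ge (b / x)
  rw [div_le_iff₀ hx0] at hn
  have he1 : ∀ᶠ t in l, ∀ k ∈ Finset.range (n + 1), M - x < Z (t - s k) :=
    (Finset.eventually_all _).2 fun k _ => hnear _ (hsM k) x hx0
  have he2 : ∀ᶠ t in l, T₀ + x₀ ≤ t := hl_top (eventually_ge_atTop _)
  have he3 : ∀ᶠ t in l, K * exp (-(δ * (t - x₀ - b))) < x := by
    refine hl_top ?_
    have : Tendsto (fun t : ℝ => K * exp (-(δ * (t - x₀ - b)))) atTop (𝓝 (K * 0)) := by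
      refine Tendsto.const_mul _ (tendsto_exp_neg_atTop_nhds_zero.comp ?_)
      refine Tendsto.const_mul_atTop hδ ?_
      simp only [sub_eq_add_neg]
      exact tendsto_atTop_add_const_right _ _ (tendsto_atTop_add_const_right _ _ tendsto_id)
    rw [mul_zero] at this
    exact this.eventually (gt_mem_nhds hx0)
  obtain ⟨t, ht1, ht2, ht3⟩ := (he1.and (he2.and he3)).exists
  have hwin : ∀ y, t - x₀ - b ≤ y → y ≤ t - x₀ → exp (-(κ * (2 * x))) * (M - x) - x ≤ Y y := by
    intro y hy1 hy2
    set k := ⌊(t - x₀ - y) / x⌋₊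
    have hk1 : k * x ≤ t - x₀ - y :=
      (le_div_iff₀ hx0).1 (Nat.floor_le (div_nonneg (by linarith) hx0.le))
    have hk2 : t - x₀ - y < (k + 1) * x := (div_lt_iff₀ hx0).1 (Nat.lt_floor_add_one _)
    have hkn : k ∈ Finset.range (n + 1) := by
      have : (k : ℝ) * x ≤ n * x := by linarith
      have : (k : ℝ) ≤ n := le_of_mul_le_mul_right this hx0
      rw [Finset.mem_range, Nat.lt_succ_iff]
      exact_mod_cast this
    have h1 := ht1 k hkn
    have h2 := hslow (t - s k) (t - s k - y) (by linarith [hs1 k])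
    rw [sub_sub_cancel] at h2
    have h3 : exp (-(κ * (2 * x))) ≤ exp (-(κ * (t - s k - y))) := by
      gcongr
      linarith [hs2 k]
    have h4 : exp (-(κ * (2 * x))) * (M - x) ≤ exp (-(κ * (2 * x))) * Z (t - s k) := by
      gcongr
    have h5 := mul_le_mul_of_nonneg_right h3 (hZ (t - s k))
    have h6 : K * exp (-(δ * y)) ≤ K * exp (-(δ * (t - x₀ - b))) := by gcongr
    simp only [hY]
    linarith
  filter_upwards [eventually_ge_atTop (t - x₀ - b)] with y hy
  have h1 := le_of_le_on_window (fun i => (hp i).le) hsum ha hi₀ hi₁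
    (fun u hu => hYsuper u (by linarith)) hwin hy
  have h2 : 0 ≤ K * exp (-(δ * y)) := by positivity
  simp only [hY] at h1
  linarith

lemma cthickening_image_of_similarity {E : Type*} [MetricSpace E] {T : E → E} {r : ℝ} (hr : 0 < r)
    (hT : ∀ x y, dist (T x) (T y) = r * dist x y) (hsurj : Function.Surjective T) {F : Set E}
    (hF : IsCompact F) {ε : ℝ} (hε : 0 ≤ ε) :
    cthickening ε (T '' F) = T '' cthickening (ε / r) F := by
  have hcont : Continuous T := (LipschitzWith.of_dist_le_mul (K := r.toNNReal) fun x y => by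
    rw [hT, Real.coe_toNNReal _ hr.le]).continuous
  rw [(hF.image hcont).cthickening_eq_biUnion_closedBall hε,
    hF.cthickening_eq_biUnion_closedBall (by positivity)]
  ext x
  obtain ⟨x, rfl⟩ := hsurj x
  have hinj : Function.Injective T := fun x y h => by
    have := hT x y
    rw [h, dist_self] at this
    exact dist_eq_zero.1 ((mul_eq_zero.1 this.symm).resolve_left hr.ne')
  rw [hinj.mem_set_image]
  simp [hT, le_div_iff₀ hr, mul_comm]

section Similarity

open scoped Pointwise

variable {E : Type*} [NormedAddCommGroup E] [InnerProductSpace ℝ E] [FiniteDimensional ℝ E]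
  [MeasurableSpace E] [BorelSpace E]

/-- A similarity of a Euclidean space is a homeomorphism that scales volume. -/
lemma exists_homeomorph_of_similarity {T : E → E} {r : ℝ} (hr : 0 < r)
    (hT : ∀ x y, dist (T x) (T y) = r * dist x y) :
    ∃ h : E ≃ₜ E, ⇑h = T ∧
      ∀ A : Set E, volume.real (T '' A) = r ^ Module.finrank ℝ E * volume.real A := by
  have hiso : Isometry fun x => r⁻¹ • T x := Isometry.of_dist_eq fun x y => by
    rw [dist_smul₀, hT, norm_inv, Real.norm_of_nonneg hr.le, inv_mul_cancel_left₀ hr.ne']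
  let A := hiso.affineIsometryOfStrictConvexSpace
  let e : E ≃ₗᵢ[ℝ] E := A.linearIsometry.toLinearIsometryEquiv rfl
  have he : ∀ x, T x = r • e x + T 0 := fun x => by
    have h := A.map_vadd 0 x
    simp only [vadd_eq_add, add_zero] at h
    change r⁻¹ • T x = e x + r⁻¹ • T 0 at h
    have h2 := congrArg (fun y => r • y) h
    simpa [smul_add, smul_smul, hr.ne'] using h2
  refine ⟨(e.toHomeomorph.trans (Homeomorph.smulOfNeZero r hr.ne')).trans
    (Homeomorph.addRight (T 0)), ?_, fun B => ?_⟩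
  · ext x
    exact (he x).symm
  · have h1 : T '' B = (fun x => x + T 0) '' (r • (e '' B)) := by
      rw [← image_smul, image_image, image_image]
      exact image_congr fun x _ => he x
    have h2 : volume (e '' B) = volume B := by
      rw [show e '' B = e.symm ⁻¹' B from e.toEquiv.image_eq_preimage_symm B]
      exact e.symm.measurePreserving.measure_preimage_emb
        e.symm.toHomeomorph.measurableEmbedding B
    rw [h1, measureReal_def, image_add_right, measure_preimage_add_right,
      Measure.addHaar_smul, h2, ENNReal.toReal_mul, ENNReal.toReal_ofReal (abs_nonneg _),
      abs_of_pos (by positivity), measureReal_def]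

end Similarity

section Words

variable {ι E : Type*}

/-- The composition of the maps of an iterated function system along a word. -/
def wordMap (S : ι → E → E) : List ι → E → E
  | [] => id
  | i :: w => S i ∘ wordMap S w

/-- The product of the ratios along a word. -/
def wordRatio (r : ι → ℝ) (w : List ι) : ℝ := (w.map r).prod

lemma wordMap_append (S : ι → E → E) (u v : List ι) :
    wordMap S (u ++ v) = wordMap S u ∘ wordMap S v := by
  induction u with
  | nil => rfl
  | cons i u ih => simp only [List.cons_append, wordMap, ih, Function.comp_assoc]

@[simp] lemma wordMap_singleton (S : ι → E → E) (i : ι) : wordMap S [i] = S i := rfl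

@[simp] lemma wordRatio_nil (r : ι → ℝ) : wordRatio r [] = 1 := rfl

@[simp] lemma wordRatio_singleton (r : ι → ℝ) (i : ι) : wordRatio r [i] = r i := by
  simp [wordRatio]

lemma wordRatio_cons (r : ι → ℝ) (i : ι) (w : List ι) :
    wordRatio r (i :: w) = r i * wordRatio r w := by
  simp [wordRatio]

lemma wordRatio_append (r : ι → ℝ) (u v : List ι) :
    wordRatio r (u ++ v) = wordRatio r u * wordRatio r v := by
  simp [wordRatio]

lemma wordRatio_pos {r : ι → ℝ} (hr : ∀ i, 0 < r i) (w : List ι) : 0 < wordRatio r w :=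
  List.prod_pos fun x hx => by
    obtain ⟨i, -, rfl⟩ := List.mem_map.1 hx
    exact hr i

lemma wordRatio_le_one {r : ι → ℝ} (hr : ∀ i, r i ∈ Ioo (0 : ℝ) 1) (w : List ι) :
    wordRatio r w ≤ 1 := by
  induction w with
  | nil => simp
  | cons i w ih =>
    rw [wordRatio_cons]
    exact mul_le_one₀ (hr i).2.le (wordRatio_pos (fun i => (hr i).1) w).le ih

lemma wordRatio_le_of_prefix {r : ι → ℝ} (hr : ∀ i, r i ∈ Ioo (0 : ℝ) 1) {u v : List ι}
    (h : u <+: v) : wordRatio r v ≤ wordRatio r u := by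
  obtain ⟨w, rfl⟩ := h
  rw [wordRatio_append]
  exact mul_le_of_le_one_right (wordRatio_pos (fun i => (hr i).1) u).le (wordRatio_le_one hr w)

lemma dist_wordMap [PseudoMetricSpace E] {S : ι → E → E} {r : ι → ℝ}
    (hS : ∀ i x y, dist (S i x) (S i y) = r i * dist x y) (w : List ι) (x y : E) :
    dist (wordMap S w x) (wordMap S w y) = wordRatio r w * dist x y := by
  induction w with
  | nil => simp [wordMap]
  | cons i w ih => simp only [wordMap, Function.comp_apply, hS, ih, wordRatio_cons, mul_assoc]

lemma exists_ratio_le [Finite ι] [Nonempty ι] {r : ι → ℝ} (hr : ∀ i, r i ∈ Ioo (0 : ℝ) 1) :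
    ∃ a ∈ Ioo (0 : ℝ) 1, ∀ i, r i ≤ a :=
  let ⟨i, hi⟩ := Finite.exists_max r
  ⟨r i, hr i, hi⟩

lemma exists_le_ratio [Finite ι] [Nonempty ι] {r : ι → ℝ} (hr : ∀ i, r i ∈ Ioo (0 : ℝ) 1) :
    ∃ a ∈ Ioo (0 : ℝ) 1, ∀ i, a ≤ r i :=
  let ⟨i, hi⟩ := Finite.exists_min r
  ⟨r i, hr i, hi⟩

/-- The piece of `F` addressed by a word. -/
def wordPiece (S : ι → E → E) (F : Set E) (w : List ι) : Set E := wordMap S w '' F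

lemma wordPiece_append (S : ι → E → E) (F : Set E) (u v : List ι) :
    wordPiece S F (u ++ v) = wordMap S u '' wordPiece S F v := by
  rw [wordPiece, wordPiece, wordMap_append, image_comp]

@[simp] lemma wordPiece_nil (S : ι → E → E) (F : Set E) : wordPiece S F [] = F := by
  simp [wordPiece, wordMap]

@[simp] lemma wordPiece_singleton (S : ι → E → E) (F : Set E) (i : ι) :
    wordPiece S F [i] = S i '' F := rfl

lemma wordPiece_eq_iUnion {S : ι → E → E} {F : Set E} (hF : F = ⋃ i, S i '' F) (w : List ι) :
    wordPiece S F w = ⋃ i, wordPiece S F (w ++ [i]) := by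
  simp only [wordPiece_append, wordPiece_singleton, ← image_iUnion, ← hF]
  rfl

/-- A compact set that is self-similar with respect to contracting similarities. -/
structure IsSelfSimilar [MetricSpace E] (S : ι → E → E) (r : ι → ℝ) (F : Set E) : Prop where
  ratio_mem : ∀ i, r i ∈ Ioo (0 : ℝ) 1
  dist_eq : ∀ i x y, dist (S i x) (S i y) = r i * dist x y
  isCompact : IsCompact F
  nonempty : F.Nonempty
  eq_iUnion : F = ⋃ i, S i '' F

/-- A feasible set for the open set condition. -/
structure IsFeasibleOpenSet [MetricSpace E] (S : ι → E → E) (O : Set E) : Prop where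
  nonempty : O.Nonempty
  isOpen : IsOpen O
  isBounded : Bornology.IsBounded O
  image_subset : ∀ i, S i '' O ⊆ O
  pairwise_disjoint : Pairwise fun i j => Disjoint (S i '' O) (S j '' O)

lemma IsSelfSimilar.ratio_pos [MetricSpace E] {S : ι → E → E} {r : ι → ℝ} {F : Set E}
    (h : IsSelfSimilar S r F) (i : ι) : 0 < r i := (h.ratio_mem i).1

lemma IsSelfSimilar.injective [MetricSpace E] {S : ι → E → E} {r : ι → ℝ} {F : Set E}
    (h : IsSelfSimilar S r F) (i : ι) : Function.Injective (S i) := fun x y hxy => by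
  have := h.dist_eq i x y
  rw [hxy, dist_self] at this
  exact dist_eq_zero.1 ((mul_eq_zero.1 this.symm).resolve_left (h.ratio_pos i).ne')

lemma IsFeasibleOpenSet.wordMap_image_subset [MetricSpace E] {S : ι → E → E} {O : Set E}
    (hO : IsFeasibleOpenSet S O) (w : List ι) : wordMap S w '' O ⊆ O := by
  induction w with
  | nil => simp [wordMap]
  | cons i w ih =>
    rw [wordMap, image_comp]
    exact (image_mono ih).trans (hO.image_subset i)

lemma IsFeasibleOpenSet.disjoint_wordMap_image [MetricSpace E] {S : ι → E → E} {O : Set E}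
    (hO : IsFeasibleOpenSet S O) (hS : ∀ i, Function.Injective (S i)) {u v : List ι}
    (huv : ¬ u <+: v) (hvu : ¬ v <+: u) : Disjoint (wordMap S u '' O) (wordMap S v '' O) := by
  induction u generalizing v with
  | nil => exact absurd List.nil_prefix huv
  | cons i u ih =>
    cases v with
    | nil => exact absurd List.nil_prefix hvu
    | cons j v =>
      simp only [wordMap, image_comp]
      by_cases hij : i = j
      · subst hij
        rw [List.prefix_cons_inj] at huv hvu
        exact (disjoint_image_iff (hS i)).2 (ih huv hvu)
      · exact (hO.pairwise_disjoint hij).mono (image_mono (hO.wordMap_image_subset u))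
          (image_mono (hO.wordMap_image_subset v))

/-- Stopping the address of a point of `F` at the first moment when the scale drops to `ρ`. -/
lemma IsSelfSimilar.exists_stopped_word [MetricSpace E] [Finite ι] {S : ι → E → E} {r : ι → ℝ}
    {F : Set E} (h : IsSelfSimilar S r F) {z : E} {j : ι} (hz : z ∈ wordPiece S F [j]) {ρ : ℝ}
    (hρ0 : 0 < ρ) (hρ1 : ρ < 1) :
    ∃ p k, [j] <+: p ++ [k] ∧ z ∈ wordPiece S F (p ++ [k]) ∧ wordRatio r (p ++ [k]) ≤ ρ ∧
      ρ < wordRatio r p := by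
  have : Nonempty ι := ⟨j⟩
  obtain ⟨a, ha, hra⟩ := exists_ratio_le h.ratio_mem
  have key : ∀ n : ℕ, ∀ p, [j] <+: p → z ∈ wordPiece S F p → ρ < wordRatio r p →
      wordRatio r p * a ^ n ≤ ρ → ∃ p k, [j] <+: p ++ [k] ∧ z ∈ wordPiece S F (p ++ [k]) ∧
        wordRatio r (p ++ [k]) ≤ ρ ∧ ρ < wordRatio r p := by
    intro n
    induction n with
    | zero => intro p _ _ h1 h2; simp at h2; linarith
    | succ n ih =>
      intro p hp hzp h1 h2
      rw [wordPiece_eq_iUnion h.eq_iUnion, mem_iUnion] at hzp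
      obtain ⟨k, hk⟩ := hzp
      have hpk : [j] <+: p ++ [k] := hp.trans (List.prefix_append _ _)
      by_cases hle : wordRatio r (p ++ [k]) ≤ ρ
      · exact ⟨p, k, hpk, hk, hle, h1⟩
      · refine ih _ hpk hk (not_le.1 hle) (le_trans ?_ h2)
        rw [wordRatio_append, wordRatio_singleton, pow_succ', mul_assoc]
        have := wordRatio_pos h.ratio_pos p
        have := ha.1
        gcongr
        exact hra k
  by_cases hj : r j ≤ ρ
  · exact ⟨[], j, by simp, by simpa using hz, by simpa using hj, by simpa using hρ1⟩
  · obtain ⟨n, hn⟩ := exists_pow_lt_of_lt_one hρ0 ha.2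
    refine key n [j] (List.prefix_refl _) hz (by simpa using hj) (le_trans ?_ hn.le)
    exact mul_le_of_le_one_left (pow_nonneg ha.1.le n) (wordRatio_le_one h.ratio_mem _)

/-- Any word can be completed to a cover of every piece, with control on the remaining words. -/
lemma exists_finset_wordPiece_subset [Fintype ι] {S : ι → E → E} {r : ι → ℝ} {F : Set E}
    (hr : ∀ i, 0 < r i) (hF : F = ⋃ i, S i '' F) {D : ℝ} (hD : ∑ i, r i ^ D = 1) (u : List ι) :
    ∃ T : Finset (List ι), [] ∉ T ∧
      (∀ w, wordPiece S F w ⊆ wordPiece S F (w ++ u) ∪ ⋃ v ∈ T, wordPiece S F (w ++ v)) ∧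
      ∑ v ∈ T, wordRatio r v ^ D ≤ 1 - wordRatio r u ^ D := by
  classical
  induction u with
  | nil => exact ⟨∅, by simp, by simp, by simp⟩
  | cons i u ih =>
    obtain ⟨T, hT0, hTc, hTs⟩ := ih
    refine ⟨T.image (i :: ·) ∪ (Finset.univ.erase i).image fun j => [j], by simp, ?_, ?_⟩
    · intro w x hx
      rw [wordPiece_eq_iUnion hF, mem_iUnion] at hx
      obtain ⟨j, hj⟩ := hx
      by_cases hji : j = i
      · subst hji
        rcases hTc _ hj with h | h
        · left; simpa using h
        · right
          simp only [mem_iUnion] at h ⊢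
          obtain ⟨v, hv, hx⟩ := h
          exact ⟨j :: v, Finset.mem_union_left _ (Finset.mem_image_of_mem _ hv), by simpa using hx⟩
      · right
        simp only [mem_iUnion]
        exact ⟨[j], Finset.mem_union_right _ (Finset.mem_image_of_mem _ (by simpa using hji)), hj⟩
    · have hpos : ∀ v, 0 ≤ wordRatio r v ^ D := fun v => rpow_nonneg (wordRatio_pos hr v).le _
      have h1 := Finset.sum_union_inter (s₁ := T.image (i :: ·))
        (s₂ := (Finset.univ.erase i).image fun j => [j]) (f := fun v => wordRatio r v ^ D)
      have h2 := Finset.sum_nonneg fun v (_ : v ∈ T.image (i :: ·) ∩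
        (Finset.univ.erase i).image fun j => [j]) => hpos v
      rw [Finset.sum_image (by simp), Finset.sum_image (by simp)] at h1
      rw [← Finset.add_sum_erase _ _ (Finset.mem_univ i)] at hD
      have h3 : ∀ v, wordRatio r (i :: v) ^ D = r i ^ D * wordRatio r v ^ D := fun v => by
        rw [wordRatio_cons, mul_rpow (hr i).le (wordRatio_pos hr v).le]
      simp only [h3, ← Finset.mul_sum, wordRatio_singleton] at h1 ⊢
      have h4 := mul_le_mul_of_nonneg_left hTs (rpow_nonneg (hr i).le D)
      linarith

end Words

section Pieces

variable {ι E : Type*} [MetricSpace E] {S : ι → E → E} {r : ι → ℝ} {F : Set E}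

lemma IsSelfSimilar.isCompact_wordPiece (h : IsSelfSimilar S r F) (w : List ι) :
    IsCompact (wordPiece S F w) :=
  h.isCompact.image (LipschitzWith.of_dist_le_mul (K := (wordRatio r w).toNNReal) fun x y => by
    rw [dist_wordMap h.dist_eq, Real.coe_toNNReal _ (wordRatio_pos h.ratio_pos w).le]).continuous

lemma IsSelfSimilar.mem_cthickening_wordPiece (h : IsSelfSimilar S r F) (w : List ι) {ε : ℝ}
    (hε : 0 ≤ ε) {x : E} :
    x ∈ cthickening ε (wordPiece S F w) ↔ ∃ y ∈ wordPiece S F w, dist x y ≤ ε := by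
  rw [(h.isCompact_wordPiece w).cthickening_eq_biUnion_closedBall hε]
  simp

lemma IsSelfSimilar.cthickening_eq_iUnion (h : IsSelfSimilar S r F) {ε : ℝ} (hε : 0 ≤ ε) :
    cthickening ε F = ⋃ i, cthickening ε (wordPiece S F [i]) := by
  ext x
  have h1 := h.mem_cthickening_wordPiece [] hε (x := x)
  rw [wordPiece_nil] at h1
  simp only [mem_iUnion, h.mem_cthickening_wordPiece _ hε, h1]
  constructor
  · rintro ⟨y, hy, hxy⟩
    obtain ⟨i, hi⟩ := mem_iUnion.1 (h.eq_iUnion.subset hy)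
    exact ⟨i, y, hi, hxy⟩
  · rintro ⟨i, y, hy, hxy⟩
    exact ⟨y, h.eq_iUnion.symm.subset (mem_iUnion.2 ⟨i, hy⟩), hxy⟩

/-- The piece addressed by `v` has about the size of the piece addressed by `u` and is close
to it. -/
def IsNeighbor (S : ι → E → E) (r : ι → ℝ) (F : Set E) (u v : List ι) : Prop :=
  (∃ p k, v = p ++ [k] ∧ wordRatio r u < wordRatio r p) ∧ wordRatio r v ≤ wordRatio r u ∧
    ∃ y ∈ wordPiece S F u, ∃ z ∈ wordPiece S F v, dist y z < wordRatio r u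

lemma IsNeighbor.append_left (hr : ∀ i, 0 < r i)
    (hS : ∀ i x y, dist (S i x) (S i y) = r i * dist x y) {u v : List ι}
    (h : IsNeighbor S r F u v) (w : List ι) : IsNeighbor S r F (w ++ u) (w ++ v) := by
  obtain ⟨⟨p, k, rfl, hp⟩, hle, y, hy, z, hz, hyz⟩ := h
  have hw := wordRatio_pos hr w
  refine ⟨⟨w ++ p, k, by simp, ?_⟩, ?_, wordMap S w y, ?_, wordMap S w z, ?_, ?_⟩
  · rw [wordRatio_append, wordRatio_append]; exact mul_lt_mul_of_pos_left hp hw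
  · rw [wordRatio_append r w, wordRatio_append r w]; exact mul_le_mul_of_nonneg_left hle hw.le
  · rw [wordPiece_append]; exact mem_image_of_mem _ hy
  · rw [wordPiece_append]; exact mem_image_of_mem _ hz
  · rw [dist_wordMap hS, wordRatio_append]; exact mul_lt_mul_of_pos_left hyz hw

lemma IsNeighbor.eq_of_prefix (hr : ∀ i, r i ∈ Ioo (0 : ℝ) 1) {u v v' : List ι}
    (h : IsNeighbor S r F u v) (h' : IsNeighbor S r F u v') (hvv' : v <+: v') : v = v' := by
  obtain ⟨⟨p, k, rfl, hp⟩, -⟩ := h'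
  rcases List.prefix_concat_iff.1 hvv' with h1 | h1
  · exact h1
  · exact absurd ((wordRatio_le_of_prefix hr h1).trans h.2.1) (not_le.2 hp)

end Pieces

section Separation

variable {ι E : Type*} [NormedAddCommGroup E] [InnerProductSpace ℝ E] [FiniteDimensional ℝ E]
  [MeasurableSpace E] [BorelSpace E] {S : ι → E → E} {r : ι → ℝ} {F O : Set E}

lemma exists_card_neighbors_le [Finite ι] [Nonempty ι] (h : IsSelfSimilar S r F)
    (hO : IsFeasibleOpenSet S O) :
    ∃ γ : ℕ, ∀ u, ∀ J : Finset (List ι), (∀ v ∈ J, IsNeighbor S r F u v) → J.card ≤ γ := by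
  obtain ⟨a, ha, har⟩ := exists_le_ratio h.ratio_mem
  obtain ⟨y₀, hy₀⟩ := h.nonempty
  obtain ⟨R, hR⟩ := (h.isCompact.isBounded.union hO.isBounded).subset_closedBall y₀
  have hR0 : 0 ≤ R := dist_nonneg.trans (mem_closedBall.1 (hR (Or.inl hy₀)))
  have hOpos : 0 < volume.real O :=
    ENNReal.toReal_pos (hO.isOpen.measure_pos _ hO.nonempty).ne' hO.isBounded.measure_lt_top.ne
  set n := Module.finrank ℝ E
  have hn : 0 < a ^ n * volume.real O := mul_pos (pow_pos ha.1 n) hOpos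
  obtain ⟨γ, hγ⟩ := exists_nat_ge ((4 * R + 1) ^ n * volume.real (ball (0 : E) 1) /
    (a ^ n * volume.real O))
  refine ⟨γ, fun u J hJ => ?_⟩
  have hu := wordRatio_pos h.ratio_pos u
  have hsim : ∀ v : List ι, ∃ f : E ≃ₜ E, ⇑f = wordMap S v ∧ ∀ A : Set E,
      volume.real (wordMap S v '' A) = wordRatio r v ^ n * volume.real A := fun v =>
    exists_homeomorph_of_similarity (wordRatio_pos h.ratio_pos v) (dist_wordMap h.dist_eq v)
  have hsub : ⋃ v ∈ J, wordMap S v '' O ⊆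
      closedBall (wordMap S u y₀) ((4 * R + 1) * wordRatio r u) := by
    refine iUnion₂_subset fun v hv => ?_
    rintro _ ⟨o, ho, rfl⟩
    obtain ⟨-, hle, _, ⟨y, hy, rfl⟩, _, ⟨z, hz, rfl⟩, hyz⟩ := hJ v hv
    have h1 : dist (wordMap S v o) (wordMap S v z) ≤ wordRatio r u * (R + R) := by
      rw [dist_wordMap h.dist_eq]
      have h2 : dist o z ≤ R + R := (dist_triangle_right o z y₀).trans
        (add_le_add (hR (Or.inr ho)) (hR (Or.inl hz)))
      gcongr
    have h3 : dist (wordMap S u y) (wordMap S u y₀) ≤ wordRatio r u * R := by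
      rw [dist_wordMap h.dist_eq]
      have h2 := mem_closedBall.1 (hR (Or.inl hy))
      gcongr
    rw [mem_closedBall]
    have h4 := dist_triangle4 (wordMap S v o) (wordMap S v z) (wordMap S u y) (wordMap S u y₀)
    rw [dist_comm (wordMap S v z)] at h4
    nlinarith [mul_nonneg hu.le hR0]
  have hvol : volume.real (⋃ v ∈ J, wordMap S v '' O) =
      ∑ v ∈ J, volume.real (wordMap S v '' O) := by
    refine measureReal_biUnion_finset (fun v hv v' hv' hne => ?_) (fun v hv => ?_) (fun v hv => ?_)
    · exact hO.disjoint_wordMap_image h.injective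
        (fun hp => hne ((hJ v hv).eq_of_prefix h.ratio_mem (hJ v' hv') hp))
        (fun hp => hne ((hJ v' hv').eq_of_prefix h.ratio_mem (hJ v hv) hp).symm)
    · obtain ⟨f, hf, -⟩ := hsim v
      rw [← hf]
      exact (f.isOpenMap _ hO.isOpen).measurableSet
    · exact (hO.isBounded.subset (hO.wordMap_image_subset v)).measure_lt_top.ne
  have hlow : J.card * (wordRatio r u ^ n * (a ^ n * volume.real O)) ≤
      volume.real (⋃ v ∈ J, wordMap S v '' O) := by
    rw [hvol, ← nsmul_eq_mul]
    refine Finset.card_nsmul_le_sum _ _ _ fun v hv => ?_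
    obtain ⟨f, -, hf⟩ := hsim v
    obtain ⟨⟨p, k, rfl, hp⟩, -⟩ := hJ v hv
    rw [hf, ← mul_assoc, ← mul_pow, wordRatio_append, wordRatio_singleton]
    have h1 := ha.1.le
    have h2 : wordRatio r u * a ≤ wordRatio r p * r k :=
      mul_le_mul hp.le (har k) h1 (hu.trans hp).le
    gcongr
  have hupp := measureReal_mono hsub (μ := volume) isBounded_closedBall.measure_lt_top.ne
  rw [Measure.addHaar_real_closedBall _ _ (by positivity), mul_pow] at hupp
  have hfin : (J.card : ℝ) * (a ^ n * volume.real O) ≤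
      (4 * R + 1) ^ n * volume.real (ball (0 : E) 1) := by
    refine le_of_mul_le_mul_left ?_ (pow_pos hu n)
    linarith
  rw [div_le_iff₀ hn] at hγ
  exact_mod_cast le_of_mul_le_mul_right (hfin.trans hγ) hn

/-- Under the open set condition there is a word whose occurrences separate a piece from all the
other first-level pieces. -/
theorem exists_separating_word [Finite ι] [Nonempty ι] (h : IsSelfSimilar S r F)
    (hO : IsFeasibleOpenSet S O) :
    ∃ u, ∀ i j, i ≠ j → ∀ w, ∀ y ∈ wordPiece S F (i :: w ++ u), ∀ z ∈ wordPiece S F [j],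
      wordRatio r (i :: w ++ u) ≤ dist y z := by
  classical
  obtain ⟨γ, hγ⟩ := exists_card_neighbors_le h hO
  let P : ℕ → Prop := fun m => ∃ u, ∃ J : Finset (List ι),
    (∀ v ∈ J, IsNeighbor S r F u v) ∧ J.card = m
  have hP0 : P 0 := ⟨[], ∅, by simp, rfl⟩
  obtain ⟨u, J, hJ, hJm⟩ : P (Nat.findGreatest P γ) := Nat.findGreatest_spec (Nat.zero_le γ) hP0
  refine ⟨u, fun i j hij w y hy z hz => ?_⟩
  by_contra! hlt
  have hlt1 : wordRatio r (i :: w ++ u) < 1 := by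
    rw [List.cons_append, wordRatio_cons]
    exact (mul_le_of_le_one_right (h.ratio_pos i).le (wordRatio_le_one h.ratio_mem _)).trans_lt
      (h.ratio_mem i).2
  obtain ⟨p, k, hjp, hzp, hle, hlt'⟩ :=
    h.exists_stopped_word hz (wordRatio_pos h.ratio_pos (i :: w ++ u)) hlt1
  have hnb : IsNeighbor S r F (i :: w ++ u) (p ++ [k]) :=
    ⟨⟨p, k, rfl, hlt'⟩, hle, y, hy, z, hzp, hlt⟩
  have hmem : p ++ [k] ∉ J.image ((i :: w) ++ ·) := by
    intro hm
    obtain ⟨v, -, hv⟩ := Finset.mem_image.1 hm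
    rw [← hv, List.cons_append, List.cons_prefix_cons] at hjp
    exact hij hjp.1.symm
  have hnb' : ∀ v ∈ insert (p ++ [k]) (J.image ((i :: w) ++ ·)),
      IsNeighbor S r F (i :: w ++ u) v := by
    intro v hv
    rcases Finset.mem_insert.1 hv with rfl | hv
    · exact hnb
    · obtain ⟨v, hvJ, rfl⟩ := Finset.mem_image.1 hv
      exact (hJ v hvJ).append_left h.ratio_pos h.dist_eq _
  have hcard : (insert (p ++ [k]) (J.image ((i :: w) ++ ·))).card = Nat.findGreatest P γ + 1 := by
    rw [Finset.card_insert_of_notMem hmem,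
      Finset.card_image_of_injective _ (List.append_right_injective _), hJm]
  have hP : P (Nat.findGreatest P γ + 1) := ⟨_, _, hnb', hcard⟩
  have := Nat.le_findGreatest (hcard ▸ hγ _ _ hnb') hP
  omega

end Separation

lemma rpow_le_rpow_add_rpow {a b x : ℝ} (s : ℝ) (ha : 0 < a) (hax : a ≤ x) (hxb : x ≤ b) :
    x ^ s ≤ a ^ s + b ^ s := by
  have hx := ha.trans_le hax
  have hb := hx.trans_le hxb
  rcases le_total 0 s with hs | hs
  · linarith [rpow_le_rpow hx.le hxb hs, rpow_nonneg ha.le s]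
  · linarith [rpow_le_rpow_of_nonpos ha hax hs, rpow_nonneg hb.le s]

section Volume

variable {ι E : Type*} [NormedAddCommGroup E] [InnerProductSpace ℝ E] [FiniteDimensional ℝ E]
  [MeasurableSpace E] [BorelSpace E] {S : ι → E → E} {r : ι → ℝ} {F O : Set E}

lemma measure_cthickening_ne_top {A : Set E} (hA : IsCompact A) (ε : ℝ) :
    volume (cthickening ε A) ≠ ⊤ :=
  hA.isBounded.cthickening.measure_lt_top.ne

lemma IsSelfSimilar.measureReal_cthickening_wordPiece (h : IsSelfSimilar S r F) (w : List ι)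
    {ε : ℝ} (hε : 0 ≤ ε) :
    volume.real (cthickening ε (wordPiece S F w)) =
      wordRatio r w ^ Module.finrank ℝ E * volume.real (cthickening (ε / wordRatio r w) F) := by
  have hw := wordRatio_pos h.ratio_pos w
  obtain ⟨f, hf, hvol⟩ := exists_homeomorph_of_similarity hw (dist_wordMap h.dist_eq w)
  rw [← hvol, wordPiece, cthickening_image_of_similarity hw (dist_wordMap h.dist_eq w)
    (hf ▸ f.surjective) h.isCompact hε]

/-- Under the open set condition, the parallel sets of two first-level pieces overlap in a set whose
volume is of smaller order than that of the parallel set. -/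
theorem exists_overlap_le [Fintype ι] [Nonempty ι] (h : IsSelfSimilar S r F)
    (hO : IsFeasibleOpenSet S O) {D : ℝ} (hD : ∑ i, r i ^ D = 1) :
    ∃ D' < D, ∃ C, 0 ≤ C ∧ ∀ ε, 0 < ε → ε ≤ 1 → ∀ i j, i ≠ j →
      volume.real (cthickening ε (wordPiece S F [i]) ∩ cthickening ε (wordPiece S F [j])) ≤
        C * ε ^ ((Module.finrank ℝ E : ℝ) - D') := by
  set n := Module.finrank ℝ E
  obtain ⟨u, hu⟩ := exists_separating_word h hO
  obtain ⟨T, hT0, hTc, hTs⟩ := exists_finset_wordPiece_subset h.ratio_pos h.eq_iUnion hD u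
  have hpos := fun w => wordRatio_pos h.ratio_pos w
  obtain ⟨D', hD'T, hD'⟩ : ∃ D', ∑ v ∈ T, wordRatio r v ^ D' < 1 ∧ D' < D := by
    have hcont : Continuous fun s : ℝ => ∑ v ∈ T, wordRatio r v ^ s :=
      continuous_finsetSum _ fun v _ => continuous_const_rpow (hpos v).ne'
    have hlt : ∑ v ∈ T, wordRatio r v ^ D < 1 := by linarith [rpow_pos_of_pos (hpos u) D]
    have h1 : ∀ᶠ s in 𝓝[<] D, ∑ v ∈ T, wordRatio r v ^ s < 1 :=
      ((hcont.tendsto D).mono_left nhdsWithin_le_nhds).eventually (gt_mem_nhds hlt)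
    exact (h1.and self_mem_nhdsWithin).exists
  obtain ⟨ρ, hρ, hrρ⟩ := exists_ratio_le h.ratio_mem
  obtain ⟨a, ha, har⟩ := exists_le_ratio h.ratio_mem
  obtain ⟨κ, hκ, hκa, hκT⟩ : ∃ κ, 0 < κ ∧ κ ≤ a ∧ ∀ v ∈ T, κ ≤ wordRatio r v := by
    have h1 : ∀ᶠ κ in 𝓝[>] (0 : ℝ), κ ≤ a ∧ ∀ v ∈ T, κ ≤ wordRatio r v :=
      nhdsWithin_le_nhds ((eventually_le_nhds ha.1).and
        ((Finset.eventually_all _).2 fun v _ => eventually_le_nhds (hpos v)))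
    obtain ⟨κ, hκ, hκ0⟩ := (h1.and self_mem_nhdsWithin).exists
    exact ⟨κ, hκ0, hκ⟩
  set s := (n : ℝ) - D' with hs
  obtain ⟨C, hC⟩ : ∃ C, C = (κ ^ s + (2 / wordRatio r u) ^ s) *
    volume.real (cthickening (1 / κ) F) := ⟨_, rfl⟩
  have hC0 : 0 ≤ C := by have := hpos u; rw [hC]; positivity
  have hsum0 : 0 ≤ ∑ i, r i ^ D' := Finset.sum_nonneg fun i _ => rpow_nonneg (h.ratio_pos i).le _
  refine ⟨D', hD', C * ∑ i, r i ^ D', mul_nonneg hC0 hsum0, fun ε hε hε1 i j hij => ?_⟩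
  have hbase : ∀ w, κ * ε ≤ wordRatio r w → wordRatio r (w ++ u) ≤ 2 * ε →
      volume.real (cthickening ε (wordPiece S F w) ∩ cthickening ε (wordPiece S F [j])) ≤
        C * ε ^ s * wordRatio r w ^ D' := by
    intro w hw1 hw2
    have hw := hpos w
    rw [wordRatio_append] at hw2
    calc _ ≤ volume.real (cthickening ε (wordPiece S F w)) :=
          measureReal_mono inter_subset_left
            (measure_cthickening_ne_top (h.isCompact_wordPiece w) ε)
      _ = wordRatio r w ^ n * volume.real (cthickening (ε / wordRatio r w) F) :=
          h.measureReal_cthickening_wordPiece w hε.le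
      _ ≤ wordRatio r w ^ n * volume.real (cthickening (1 / κ) F) := by
          refine mul_le_mul_of_nonneg_left (measureReal_mono (cthickening_mono ?_ F)
            (measure_cthickening_ne_top h.isCompact _)) (by positivity)
          rw [div_le_div_iff₀ hw hκ]
          linarith
      _ = (wordRatio r w / ε) ^ s * volume.real (cthickening (1 / κ) F) * ε ^ s *
            wordRatio r w ^ D' := by
          rw [div_rpow hw.le hε.le, ← rpow_natCast, show (n : ℝ) = s + D' by rw [hs]; ring,
            rpow_add hw]
          have := rpow_pos_of_pos hε s
          field_simp
      _ ≤ C * ε ^ s * wordRatio r w ^ D' := by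
          have h1 : (wordRatio r w / ε) ^ s ≤ κ ^ s + (2 / wordRatio r u) ^ s := by
            refine rpow_le_rpow_add_rpow s hκ ?_ ?_
            · rwa [le_div_iff₀ hε]
            · rwa [div_le_div_iff₀ hε (hpos u)]
          rw [hC]
          gcongr
  have key : ∀ k : ℕ, ∀ w, κ * ε ≤ wordRatio r (i :: w) →
      wordRatio r (i :: w) * ρ ^ k ≤ 2 * ε →
      volume.real (cthickening ε (wordPiece S F (i :: w)) ∩ cthickening ε (wordPiece S F [j])) ≤
        C * ε ^ s * wordRatio r (i :: w) ^ D' := by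
    intro k
    induction k with
    | zero =>
      intro w hw1 hw2
      refine hbase _ hw1 ((wordRatio_le_of_prefix h.ratio_mem (List.prefix_append _ _)).trans ?_)
      simpa using hw2
    | succ k ih =>
      intro w hw1 hw2
      by_cases hwu : wordRatio r (i :: w ++ u) ≤ 2 * ε
      · exact hbase _ hw1 hwu
      rw [not_le] at hwu
      have hw := hpos (i :: w)
      have hcover : cthickening ε (wordPiece S F (i :: w)) ∩ cthickening ε (wordPiece S F [j]) ⊆
          ⋃ v ∈ T, cthickening ε (wordPiece S F (i :: (w ++ v))) ∩
            cthickening ε (wordPiece S F [j]) := by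
        rintro x ⟨hx1, hx2⟩
        obtain ⟨y, hy, hxy⟩ := (h.mem_cthickening_wordPiece _ hε.le).1 hx1
        obtain ⟨z, hz, hxz⟩ := (h.mem_cthickening_wordPiece _ hε.le).1 hx2
        rcases hTc _ hy with hyu | hyT
        · have := hu i j hij w y hyu z hz
          linarith [dist_triangle_left y z x]
        · simp only [mem_iUnion] at hyT ⊢
          obtain ⟨v, hv, hyv⟩ := hyT
          exact ⟨v, hv, (h.mem_cthickening_wordPiece _ hε.le).2 ⟨y, hyv, hxy⟩, hx2⟩
      have hfin : volume (⋃ v ∈ T, cthickening ε (wordPiece S F (i :: (w ++ v))) ∩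
            cthickening ε (wordPiece S F [j])) ≠ ⊤ := by
        refine ne_top_of_le_ne_top
          (measure_cthickening_ne_top (h.isCompact_wordPiece [j]) ε) (measure_mono ?_)
        exact iUnion₂_subset fun v _ => inter_subset_right
      refine (measureReal_mono hcover hfin).trans ((measureReal_biUnion_finset_le _ _).trans ?_)
      calc _ ≤ ∑ v ∈ T, C * ε ^ s * wordRatio r (i :: (w ++ v)) ^ D' := by
            refine Finset.sum_le_sum fun v hv => ih _ ?_ ?_
            · have h1 := hκT v hv
              have h2 := wordRatio_le_one h.ratio_mem u
              rw [wordRatio_append] at hwu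
              rw [← List.cons_append, wordRatio_append, mul_comm κ]
              exact mul_le_mul (by nlinarith) h1 hκ.le hw.le
            · refine le_trans ?_ hw2
              rw [← List.cons_append, wordRatio_append, pow_succ', mul_assoc]
              have hvρ : wordRatio r v ≤ ρ := by
                cases v with
                | nil => exact absurd hv hT0
                | cons m v =>
                  rw [wordRatio_cons]
                  exact (mul_le_of_le_one_right (h.ratio_pos m).le
                    (wordRatio_le_one h.ratio_mem _)).trans (hrρ m)
              have := hρ.1.le
              gcongr
        _ = C * ε ^ s * wordRatio r (i :: w) ^ D' * ∑ v ∈ T, wordRatio r v ^ D' := by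
            rw [Finset.mul_sum]
            refine Finset.sum_congr rfl fun v _ => ?_
            rw [← List.cons_append, wordRatio_append, mul_rpow hw.le (hpos v).le]
            ring
        _ ≤ _ := mul_le_of_le_one_right (by positivity) hD'T.le
  obtain ⟨k, hk⟩ := exists_pow_lt_of_lt_one hε hρ.2
  have hfinal := key k [] ?_ ?_
  · refine hfinal.trans ?_
    rw [wordRatio_singleton, mul_right_comm]
    have h1 : r i ^ D' ≤ ∑ i, r i ^ D' :=
      Finset.single_le_sum (f := fun i => r i ^ D')
        (fun i _ => rpow_nonneg (h.ratio_pos i).le _) (Finset.mem_univ i)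
    gcongr
  · rw [wordRatio_singleton]
    nlinarith [har i]
  · have := mul_le_of_le_one_left (pow_nonneg hρ.1.le k) (wordRatio_le_one h.ratio_mem [i])
    linarith

lemma sum_measureReal_le_add_overlaps {α : Type*} [MeasurableSpace α] {μ : Measure α} [Fintype ι]
    [DecidableEq ι] {A : ι → Set α} (hA : ∀ i, MeasurableSet (A i)) (hfin : ∀ i, μ (A i) ≠ ⊤) :
    ∑ i, μ.real (A i) ≤
      μ.real (⋃ i, A i) + ∑ i, ∑ j ∈ Finset.univ.erase i, μ.real (A i ∩ A j) := by
  set B : ι → Set α := fun i => A i \ ⋃ j ∈ Finset.univ.erase i, A j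
  have hBA : ∀ i, B i ⊆ A i := fun i => sdiff_subset
  have hBmeas : ∀ i, MeasurableSet (B i) := fun i =>
    (hA i).diff (Finset.measurableSet_biUnion _ fun j _ => hA j)
  have hBdisj : Pairwise (Function.onFun Disjoint B) := fun i j hij => by
    refine disjoint_left.2 fun x hxi hxj => hxi.2 ?_
    exact mem_biUnion (Finset.mem_erase.2 ⟨hij.symm, Finset.mem_univ j⟩) hxj.1
  have hunion : μ (⋃ i, A i) ≠ ⊤ := by
    have := measure_biUnion_lt_top (s := univ) (μ := μ) (f := A) finite_univ
      fun i _ => (hfin i).lt_top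
    simpa using this.ne
  have h1 : ∑ i, μ.real (B i) ≤ μ.real (⋃ i, A i) := by
    rw [← measureReal_iUnion_fintype hBdisj hBmeas
      fun i => measure_ne_top_of_subset (hBA i) (hfin i)]
    exact measureReal_mono (iUnion_mono hBA) hunion
  have h2 : ∀ i, μ.real (A i) ≤ μ.real (B i) + ∑ j ∈ Finset.univ.erase i, μ.real (A i ∩ A j) := by
    intro i
    have hsub : A i ⊆ B i ∪ ⋃ j ∈ Finset.univ.erase i, A i ∩ A j := by
      intro x hx
      by_cases h : x ∈ ⋃ j ∈ Finset.univ.erase i, A j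
      · right
        simp only [mem_iUnion] at h ⊢
        obtain ⟨j, hj, hxj⟩ := h
        exact ⟨j, hj, hx, hxj⟩
      · exact Or.inl ⟨hx, h⟩
    have hsub' : B i ∪ ⋃ j ∈ Finset.univ.erase i, A i ∩ A j ⊆ A i :=
      union_subset (hBA i) (iUnion₂_subset fun j _ => inter_subset_left)
    refine (measureReal_mono hsub (measure_ne_top_of_subset hsub' (hfin i))).trans
      ((measureReal_union_le _ _).trans ?_)
    gcongr
    exact measureReal_biUnion_finset_le _ _
  calc ∑ i, μ.real (A i) ≤ ∑ i, (μ.real (B i) + ∑ j ∈ Finset.univ.erase i, μ.real (A i ∩ A j)) :=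
        Finset.sum_le_sum fun i _ => h2 i
    _ ≤ _ := by rw [Finset.sum_add_distrib]; gcongr

lemma IsSelfSimilar.measureReal_cthickening_le [Fintype ι] (h : IsSelfSimilar S r F) {ε : ℝ}
    (hε : 0 ≤ ε) :
    volume.real (cthickening ε F) ≤
      ∑ i, r i ^ Module.finrank ℝ E * volume.real (cthickening (ε / r i) F) := by
  rw [h.cthickening_eq_iUnion hε]
  refine (measureReal_iUnion_fintype_le _).trans_eq (Finset.sum_congr rfl fun i _ => ?_)
  rw [h.measureReal_cthickening_wordPiece [i] hε, wordRatio_singleton]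

lemma IsSelfSimilar.sum_measureReal_cthickening_le [Fintype ι] [DecidableEq ι]
    (h : IsSelfSimilar S r F) {ε : ℝ} (hε : 0 ≤ ε) :
    ∑ i, r i ^ Module.finrank ℝ E * volume.real (cthickening (ε / r i) F) ≤
      volume.real (cthickening ε F) + ∑ i, ∑ j ∈ Finset.univ.erase i,
        volume.real (cthickening ε (wordPiece S F [i]) ∩ cthickening ε (wordPiece S F [j])) := by
  have h1 := sum_measureReal_le_add_overlaps (μ := volume)
    (A := fun i => cthickening ε (wordPiece S F [i])) (fun i => isClosed_cthickening.measurableSet)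
    (fun i => measure_cthickening_ne_top (h.isCompact_wordPiece [i]) ε)
  rw [← h.cthickening_eq_iUnion hε] at h1
  refine le_trans (Finset.sum_le_sum fun i _ => ?_) h1
  rw [h.measureReal_cthickening_wordPiece [i] hε, wordRatio_singleton]

lemma IsSelfSimilar.sum_measureReal_cthickening_inter_le [Fintype ι] (h : IsSelfSimilar S r F)
    (hO : IsFeasibleOpenSet S O) {ε : ℝ} (hε : 0 ≤ ε) :
    ∑ i, r i ^ Module.finrank ℝ E * volume.real (cthickening (ε / r i) F ∩ O) ≤
      volume.real (cthickening ε F ∩ O) := by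
  have hsim : ∀ i, ∃ f : E ≃ₜ E, ⇑f = S i ∧ ∀ A : Set E,
      volume.real (S i '' A) = r i ^ Module.finrank ℝ E * volume.real A := fun i =>
    exists_homeomorph_of_similarity (h.ratio_pos i) (h.dist_eq i)
  have hsub : ∀ i, S i '' (cthickening (ε / r i) F ∩ O) ⊆ cthickening ε F ∩ O := fun i => by
    obtain ⟨f, hf, -⟩ := hsim i
    refine (image_inter_subset _ _ _).trans (inter_subset_inter ?_ (hO.image_subset i))
    rw [← cthickening_image_of_similarity (h.ratio_pos i) (h.dist_eq i) (hf ▸ f.surjective)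
      h.isCompact hε, h.cthickening_eq_iUnion hε]
    exact subset_iUnion (fun i => cthickening ε (wordPiece S F [i])) i
  have hfin : volume (cthickening ε F ∩ O) ≠ ⊤ :=
    measure_ne_top_of_subset inter_subset_left (measure_cthickening_ne_top h.isCompact ε)
  calc _ = ∑ i, volume.real (S i '' (cthickening (ε / r i) F ∩ O)) :=
        Finset.sum_congr rfl fun i _ => by
          obtain ⟨-, -, hf⟩ := hsim i
          rw [hf]
    _ = volume.real (⋃ i, S i '' (cthickening (ε / r i) F ∩ O)) := by
        refine (measureReal_iUnion_fintype ?_ ?_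
          fun i => measure_ne_top_of_subset (hsub i) hfin).symm
        · exact fun i j hij => (hO.pairwise_disjoint hij).mono (image_mono inter_subset_right)
            (image_mono inter_subset_right)
        · intro i
          obtain ⟨f, hf, -⟩ := hsim i
          rw [← hf]
          exact f.measurableEmbedding.measurableSet_image.2
            (isClosed_cthickening.measurableSet.inter hO.isOpen.measurableSet)
    _ ≤ _ := measureReal_mono (iUnion_subset hsub) hfin

lemma scaled_exp_neg_sub {ρ : ℝ} (hρ : 0 < ρ) (n : ℕ) (D t : ℝ) (W : ℝ → ℝ) :
    ρ ^ D * (W (exp (-(t - -log ρ))) / exp (-(t - -log ρ)) ^ ((n : ℝ) - D)) =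
      ρ ^ n * W (exp (-t) / ρ) / exp (-t) ^ ((n : ℝ) - D) := by
  have h1 : exp (-(t - -log ρ)) = exp (-t) / ρ := by
    rw [show -(t - -log ρ) = -t - log ρ by ring, exp_sub, exp_log hρ]
  rw [h1, div_rpow (exp_pos _).le hρ.le, ← rpow_natCast ρ n,
    show (n : ℝ) = D + ((n : ℝ) - D) by ring, rpow_add hρ, add_sub_cancel_left]
  have := rpow_pos_of_pos hρ ((n : ℝ) - D)
  have := rpow_pos_of_pos (exp_pos (-t)) ((n : ℝ) - D)
  field_simp

lemma IsSelfSimilar.exists_pos_le_volume [Fintype ι] [Nonempty ι] (h : IsSelfSimilar S r F)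
    (hO : IsFeasibleOpenSet S O) {D : ℝ} (hD : ∑ i, r i ^ D = 1) :
    ∃ m, 0 < m ∧ ∀ᶠ t in atTop, m ≤
      volume.real (cthickening (exp (-t)) F) / exp (-t) ^ ((Module.finrank ℝ E : ℝ) - D) := by
  set s := (Module.finrank ℝ E : ℝ) - D with hs
  obtain ⟨b, hb, hbr⟩ := exists_le_ratio h.ratio_mem
  obtain ⟨a, ha, har⟩ := exists_ratio_le h.ratio_mem
  obtain ⟨y₀, hy₀⟩ := h.nonempty
  obtain ⟨R, hR0, hR⟩ := hO.isBounded.subset_closedBall_lt 0 y₀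
  have hOpos : 0 < volume.real O :=
    ENNReal.toReal_pos (hO.isOpen.measure_pos _ hO.nonempty).ne' hO.isBounded.measure_lt_top.ne
  set T := -log R
  set m := volume.real O * exp (-(|s| * (|T| + -log b)))
  set Y : ℝ → ℝ := fun t => volume.real (cthickening (exp (-t)) F ∩ O) / exp (-t) ^ s
  have hlogb : 0 < -log b := neg_pos.2 (log_neg hb.1 hb.2)
  have hY : ∀ t, T - -log b ≤ t → m ≤ Y t := by
    intro t ht
    refine le_of_le_on_window (p := fun i => r i ^ D) (c := fun i => -log (r i)) (a := -log a)
      (fun i => rpow_nonneg (h.ratio_pos i).le _) hD (neg_pos.2 (log_neg ha.1 ha.2))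
      (fun i => neg_le_neg (log_le_log (h.ratio_pos i) (har i)))
      (fun i => neg_le_neg (log_le_log hb.1 (hbr i))) (fun t _ => ?_) (fun t ht1 ht2 => ?_) ht
    · have h1 := h.sum_measureReal_cthickening_inter_le hO (exp_pos (-t)).le
      simp only [Y]
      rw [Finset.sum_congr rfl fun i _ => scaled_exp_neg_sub (h.ratio_pos i)
        (Module.finrank ℝ E) D t fun ε => volume.real (cthickening ε F ∩ O), ← Finset.sum_div]
      exact div_le_div_of_nonneg_right h1 (rpow_nonneg (exp_pos _).le _)
    · have hRt : R ≤ exp (-t) := by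
        rw [← exp_log hR0]
        exact exp_le_exp.2 (by linarith)
      have hOsub : O ⊆ cthickening (exp (-t)) F := fun x hx =>
        mem_cthickening_of_dist_le x y₀ _ _ hy₀ ((mem_closedBall.1 (hR hx)).trans hRt)
      simp only [Y]
      rw [inter_eq_right.2 hOsub, ← exp_mul, div_eq_mul_inv, ← exp_neg]
      refine mul_le_mul_of_nonneg_left (exp_le_exp.2 ?_) hOpos.le
      have h1 : |t| ≤ |T| + -log b := by
        rw [abs_le]
        constructor <;> linarith [neg_abs_le T, le_abs_self T]
      have h2 : |t * s| ≤ (|T| + -log b) * |s| := by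
        rw [abs_mul]
        gcongr
      linarith [neg_abs_le (t * s)]
  refine ⟨m, by positivity, ?_⟩
  filter_upwards [eventually_ge_atTop (T - -log b)] with t ht
  refine (hY t ht).trans (div_le_div_of_nonneg_right (measureReal_mono inter_subset_left
    (measure_cthickening_ne_top h.isCompact _)) (rpow_nonneg (exp_pos _).le _))

/-- Non-lattice self-similar sets satisfying the open set condition are Minkowski measurable. -/
theorem IsSelfSimilar.exists_tendsto_minkowski [Fintype ι] [Nonempty ι] (h : IsSelfSimilar S r F)
    (hO : IsFeasibleOpenSet S O) {D : ℝ} (hD : ∑ i, r i ^ D = 1)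
    (hnl : ¬ ∃ a : ℝ, 0 < a ∧ ∀ i, ∃ k : ℤ, log (r i) = a * k) :
    ∃ L, 0 < L ∧ Tendsto
      (fun ε : ℝ => volume.real (cthickening ε F) / ε ^ ((Module.finrank ℝ E : ℝ) - D))
      (𝓝[>] 0) (𝓝 L) := by
  classical
  set n := Module.finrank ℝ E with hn
  set s := (n : ℝ) - D with hs
  obtain ⟨D', hD', C, hC, hoverlap⟩ := exists_overlap_le h hO hD
  set Z : ℝ → ℝ := fun t => volume.real (cthickening (exp (-t)) F) / exp (-t) ^ s with hZ
  have hZ0 : ∀ t, 0 ≤ Z t := fun t => by positivity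
  have hscale : ∀ t, ∑ i, r i ^ D * Z (t - -log (r i)) =
      (∑ i, r i ^ n * volume.real (cthickening (exp (-t) / r i) F)) / exp (-t) ^ s := fun t => by
    rw [Finset.sum_div]
    exact Finset.sum_congr rfl fun i _ => scaled_exp_neg_sub (h.ratio_pos i) n D t
      fun ε => volume.real (cthickening ε F)
  obtain ⟨L, hL⟩ : ∃ L, Tendsto Z atTop (𝓝 L) := by
    refine tendsto_of_renewal (p := fun i => r i ^ D) (c := fun i => -log (r i)) (κ := |s|)
      (C := Fintype.card ι * (Fintype.card ι * C)) (δ := D - D') (T₀ := 0)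
      (fun i => rpow_pos_of_pos (h.ratio_pos i) D) hD
      (fun i => neg_pos.2 (log_neg (h.ratio_mem i).1 (h.ratio_mem i).2)) ?_ (sub_pos.2 hD')
      (by positivity) (abs_nonneg s) hZ0 ?_ ?_ ?_
    · rintro ⟨a, ha, hk⟩
      refine hnl ⟨a, ha, fun i => ?_⟩
      obtain ⟨k, hk⟩ := hk i
      exact ⟨-k, by push_cast; linarith⟩
    · intro t u hu
      simp only [hZ, ← exp_mul]
      rw [div_eq_mul_inv, div_eq_mul_inv, ← exp_neg, ← exp_neg, mul_left_comm, ← exp_add]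
      have h1 : volume.real (cthickening (exp (-t)) F) ≤
          volume.real (cthickening (exp (-(t - u))) F) :=
        measureReal_mono (cthickening_mono (exp_le_exp.2 (by linarith)) F)
          (measure_cthickening_ne_top h.isCompact _)
      refine mul_le_mul h1 (exp_le_exp.2 ?_) (exp_pos _).le measureReal_nonneg
      nlinarith [le_abs_self s]
    · intro t
      rw [hscale]
      exact div_le_div_of_nonneg_right (h.measureReal_cthickening_le (exp_pos _).le)
        (rpow_nonneg (exp_pos _).le _)
    · intro t ht
      have hexp : 0 < exp (-t) ^ s := rpow_pos_of_pos (exp_pos _) _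
      have h1 := h.sum_measureReal_cthickening_le (exp_pos (-t)).le
      have h2 : ∑ i, ∑ j ∈ Finset.univ.erase i,
          volume.real (cthickening (exp (-t)) (wordPiece S F [i]) ∩
            cthickening (exp (-t)) (wordPiece S F [j])) ≤
          Fintype.card ι * (Fintype.card ι * (C * exp (-t) ^ ((n : ℝ) - D'))) := by
        have h3 : 0 ≤ C * exp (-t) ^ ((n : ℝ) - D') := by positivity
        rw [← nsmul_eq_mul, ← nsmul_eq_mul]
        refine Finset.sum_le_card_nsmul _ _ _ fun i _ => ?_
        refine (Finset.sum_le_card_nsmul _ _ _ fun j hj => hoverlap _ (exp_pos _)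
          (exp_le_one_iff.2 (by linarith)) i j (Finset.ne_of_mem_erase hj).symm).trans ?_
        exact nsmul_le_nsmul_left h3 (Finset.card_le_univ _)
      have h4 : exp (-((D - D') * t)) * exp (-t) ^ s = exp (-t) ^ ((n : ℝ) - D') := by
        rw [← exp_mul, ← exp_mul, ← exp_add]
        congr 1
        rw [hs]
        ring
      rw [hscale, sub_le_iff_le_add]
      simp only [hZ]
      rw [div_le_iff₀ hexp, add_mul, div_mul_cancel₀ _ hexp.ne', mul_assoc, mul_assoc, mul_assoc,
        h4]
      linarith
  obtain ⟨m, hm, hmZ⟩ := h.exists_pos_le_volume hO hD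
  refine ⟨L, hm.trans_le (ge_of_tendsto hL hmZ), ?_⟩
  have hlog : Tendsto (fun ε : ℝ => -log ε) (𝓝[>] 0) atTop :=
    tendsto_neg_atBot_atTop.comp tendsto_log_nhdsGT_zero
  refine (hL.comp hlog).congr' ?_
  filter_upwards [self_mem_nhdsWithin] with ε hε
  simp only [hZ, Function.comp_apply, neg_neg, exp_log (show (0 : ℝ) < ε from hε)]

end Volume

/-- (Gatzouras) Let `S₁, …, S_N : ℝ^d → ℝ^d` (`N ≥ 2`) be contracting similarities with ratios
`r₁, …, r_N ∈ (0,1)` satisfying the open set condition, let `F` be the attractor and `D` the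
real number with `Σ rᵢ^D = 1`. If the system is non-lattice (there is no `a > 0` with
`log rᵢ ∈ a·ℤ` for all `i`), then `F` is Minkowski measurable:
`lim_{ε→0⁺} λ^d(F_ε)/ε^(d-D)` exists in `(0, ∞)`. -/
theorem stmt_12 (d N : ℕ) (hN : 2 ≤ N)
    (S : Fin N → EuclideanSpace ℝ (Fin d) → EuclideanSpace ℝ (Fin d))
    (ratio : Fin N → ℝ) (hratio : ∀ i, ratio i ∈ Set.Ioo (0 : ℝ) 1)
    (hsim : ∀ i x y, dist (S i x) (S i y) = ratio i * dist x y)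
    (O : Set (EuclideanSpace ℝ (Fin d))) (hOne : O.Nonempty) (hOopen : IsOpen O)
    (hObdd : Bornology.IsBounded O)
    (hOsub : ∀ i, S i '' O ⊆ O)
    (hOdisj : Pairwise fun i j => Disjoint (S i '' O) (S j '' O))
    (F : Set (EuclideanSpace ℝ (Fin d))) (hFc : IsCompact F) (hFne : F.Nonempty)
    (hFinv : F = ⋃ i, S i '' F)
    (D : ℝ) (hD : ∑ i, ratio i ^ D = 1)
    (hnonlattice : ¬ ∃ a : ℝ, 0 < a ∧ ∀ i, ∃ k : ℤ, Real.log (ratio i) = a * k) :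
    ∃ L : ℝ, 0 < L ∧
      Filter.Tendsto
        (fun ε : ℝ => (volume (cthickening ε F)).toReal / ε ^ ((d : ℝ) - D))
        (𝓝[>] 0) (𝓝 L) := by
  have : Nonempty (Fin N) := ⟨⟨0, by omega⟩⟩
  have h : IsSelfSimilar S ratio F := ⟨hratio, hsim, hFc, hFne, hFinv⟩
  have hO : IsFeasibleOpenSet S O := ⟨hOne, hOopen, hObdd, hOsub, hOdisj⟩
  obtain ⟨L, hL, hlim⟩ := h.exists_tendsto_minkowski hO hD hnonlattice
  exact ⟨L, hL, by simpa [measureReal_def, finrank_euclideanSpace_fin] using hlim⟩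
end
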